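/- arXiv:math/9912142 — 2 statements merged into one kernel-verified Lean document; each statement's English description precedes it below -/
import Mathlib

section
/- Define the triple sums S_A = Σ_{z1,z2,z3} (−1)^(z1+z2+z3) · [(g−h+k+z1)!(a+c−h+z1)!(2h−z1)! / (z1!(g+h−k−z1)!(c−a+h−z1)!)] · [(2d−z2)!(c−d+f+z2)! / (z2!(d−b+k−z2)!(c+d−f−z2)!(b+d+k+1−z2)!)] · [(b+e−a+z3)!(e−f+g+z3)! / (z3!(a+b−e−z3)!(f+g−e−z3)!(2e+1+z3)!)] · [(a+d−e+k−z2−z3)! / ((a−d+f−h+z1+z2)!(e−f−h+k+z1+z3)!)] and S_B = Σ_{z1,z2,z3} (−1)^(z1+z2) · [(a+c−h+z1)!(g−h+k+z1)!(2h−z1)! / (z1!(c+h−a−z1)!(g+h−k−z1)!)] · [(2b−z2)!(b−c+f+k−z2)!(b+c+f+k+1−z2)! / (z2!(b−d+k−z2)!(b+d+k+1−z2)!)] · [(b+e−a+z3)!(e−f+g+z3)! / (z3!(a+b−e−z3)!(f+g−e−z3)!(2e+1+z3)!)] · [1 / ((e+k−f−h+z1+z3)!(b+e−a−z2+z3)!(a+b+f−h+k+1+z1−z2)!)].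 Then, under the triangle conditions of the 9j symbol, (−1)^(c+h−a) · S_A = (−1)^(e−f−h+k) · S_B (both exponents are integers). This expresses the equality of the Ališauskas–Jucys triple-sum formula for the SU(2) 9j coefficient {a b e; c d f; h k g} and the first new triple-sum formula of the paper. -/
noncomputable section

/-- Factorial of a rational argument: `x!` when `x` is a nonnegative integer,
and `0` otherwise.  Terms of a sum containing a factorial with an invalid
argument are thereby omitted: in the numerator such a factor is `0`, and in the
denominator it produces a division by zero, which is `0` in `ℚ`. -/
def fct (x : ℚ) : ℚ :=
  if 0 ≤ x ∧ x.den = 1 then (Nat.factorial x.num.toNat : ℚ) else 0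

/-- `(-1)` raised to a rational exponent (an integer whenever it matters). -/
def neg1pw (x : ℚ) : ℚ := (-1 : ℚ) ^ x.num

/-- `x` is a nonnegative half-integer. -/
def IsNNHalfInt (x : ℚ) : Prop := 0 ≤ x ∧ ∃ m : ℤ, 2 * x = (m : ℚ)

/-- The triangle condition for the triad `(x, y, z)`: the linear combinations
`x+y-z`, `x-y+z` and `-x+y+z` are all nonnegative integers. -/
def Triad (x y z : ℚ) : Prop :=
  (∃ n : ℕ, x + y - z = (n : ℚ)) ∧ (∃ n : ℕ, x - y + z = (n : ℚ)) ∧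
    (∃ n : ℕ, -x + y + z = (n : ℚ))

/-- The square `N(x,y,z)` of the asymmetric triangle coefficient `∇[xyz]`. -/
def Nsq (x y z : ℚ) : ℚ :=
  fct (x + y - z) * fct (x - y + z) * fct (x + y + z + 1) / fct (y + z - x)

/-- The Ališauskas–Jucys triple sum `S_A` for the 9j coefficient. -/
def sumSA (a b c d e f g h k : ℚ) : ℚ :=
  ∑ᶠ z1 : ℕ, ∑ᶠ z2 : ℕ, ∑ᶠ z3 : ℕ,
    (-1 : ℚ) ^ (z1 + z2 + z3) *
      (fct (g - h + k + z1) * fct (a + c - h + z1) * fct (2 * h - z1) /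
        ((Nat.factorial z1 : ℚ) * fct (g + h - k - z1) * fct (c - a + h - z1))) *
      (fct (2 * d - z2) * fct (c - d + f + z2) /
        ((Nat.factorial z2 : ℚ) * fct (d - b + k - z2) * fct (c + d - f - z2) *
          fct (b + d + k + 1 - z2))) *
      (fct (b + e - a + z3) * fct (e - f + g + z3) /
        ((Nat.factorial z3 : ℚ) * fct (a + b - e - z3) * fct (f + g - e - z3) *
          fct (2 * e + 1 + z3))) *
      (fct (a + d - e + k - z2 - z3) /
        (fct (a - d + f - h + z1 + z2) * fct (e - f - h + k + z1 + z3)))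

/-- The triple sum `S_B` of the first new triple-sum formula for the 9j
coefficient. -/
def sumSB (a b c d e f g h k : ℚ) : ℚ :=
  ∑ᶠ z1 : ℕ, ∑ᶠ z2 : ℕ, ∑ᶠ z3 : ℕ,
    (-1 : ℚ) ^ (z1 + z2) *
      (fct (a + c - h + z1) * fct (g - h + k + z1) * fct (2 * h - z1) /
        ((Nat.factorial z1 : ℚ) * fct (c + h - a - z1) * fct (g + h - k - z1))) *
      (fct (2 * b - z2) * fct (b - c + f + k - z2) * fct (b + c + f + k + 1 - z2) /
        ((Nat.factorial z2 : ℚ) * fct (b - d + k - z2) * fct (b + d + k + 1 - z2))) *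
      (fct (b + e - a + z3) * fct (e - f + g + z3) /
        ((Nat.factorial z3 : ℚ) * fct (a + b - e - z3) * fct (f + g - e - z3) *
          fct (2 * e + 1 + z3))) *
      (1 / (fct (e + k - f - h + z1 + z3) * fct (b + e - a - z2 + z3) *
        fct (a + b + f - h + k + 1 + z1 - z2)))


open Polynomial Finset

/-- Factorial of an integer, with value `0` at negative integers. -/
def zfct (n : ℤ) : ℚ := if 0 ≤ n then (n.toNat.factorial : ℚ) else 0

lemma zfct_of_neg {n : ℤ} (hn : n < 0) : zfct n = 0 := if_neg (not_le.2 hn)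

lemma zfct_natCast (n : ℕ) : zfct n = (n.factorial : ℚ) := by simp [zfct]

lemma zfct_ne_zero {n : ℤ} (hn : 0 ≤ n) : zfct n ≠ 0 := by
  simp [zfct, hn, Nat.factorial_ne_zero]

lemma zfct_add_one {n : ℤ} (hn : 0 ≤ n) : zfct (n + 1) = (n + 1) * zfct n := by
  obtain ⟨m, rfl⟩ := Int.eq_ofNat_of_zero_le hn
  have := zfct_natCast (m + 1)
  push_cast at this
  rw [this, zfct_natCast, Nat.factorial_succ]
  push_cast
  rfl

lemma fct_intCast {x : ℚ} {n : ℤ} (hx : x = n) : fct x = zfct n := by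
  subst hx
  simp [fct, zfct]

lemma neg1pw_intCast {x : ℚ} {n : ℤ} (hx : x = n) : neg1pw x = (-1) ^ n := by
  subst hx
  simp [neg1pw]

lemma finsum_nat_eq_sum_range {f : ℕ → ℚ} (n : ℕ) (hf : ∀ i, n < i → f i = 0) :
    ∑ᶠ i, f i = ∑ i ∈ range (n + 1), f i := by
  refine finsum_eq_sum_of_support_subset f fun i hi => ?_
  by_contra h
  rw [mem_coe, mem_range, not_lt] at h
  exact hi (hf i h)

/-- The polynomial `(v + 1 - X) (v + 2 - X) ⋯ (v + n - X)`, interpolating the quotient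
of factorials `(v + n - x)! / (v - x)!`. -/
def factorialQuotient (v : ℤ) (n : ℕ) : ℚ[X] :=
  ∏ i ∈ range n, (C ((v : ℚ) + 1 + i) - X)

lemma natDegree_factorialQuotient_le (v : ℤ) (n : ℕ) :
    (factorialQuotient v n).natDegree ≤ n := by
  refine (natDegree_prod_le _ _).trans ?_
  refine (sum_le_card_nsmul _ _ 1 fun i _ => ?_).trans (by simp)
  exact (natDegree_sub_le _ _).trans (max_le (by rw [natDegree_C]; exact zero_le_one) (by simp))

lemma factorialQuotient_succ (v : ℤ) (n : ℕ) :
    factorialQuotient v (n + 1) = factorialQuotient v n * (C ((v : ℚ) + 1 + n) - X) :=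
  prod_range_succ _ _

lemma eval_factorialQuotient_of_le {v t : ℤ} {n : ℕ} (ht : t ≤ v + n) :
    (factorialQuotient v n).eval (t : ℚ) = zfct (v + n - t) / zfct (v - t) := by
  induction n with
  | zero =>
    have h : 0 ≤ v - t := by push_cast at ht; omega
    simp [factorialQuotient, div_self (zfct_ne_zero h)]
  | succ n ih =>
    rw [factorialQuotient_succ, eval_mul]
    push_cast at ht ⊢
    rcases ht.eq_or_lt with rfl | ht
    · rw [zfct_of_neg (n := v - _) (by omega)]
      simp only [eval_sub, eval_C, eval_X, div_zero]
      push_cast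
      ring
    · rw [ih (by omega), show v + (n + 1 : ℤ) - t = v + n - t + 1 by ring,
        zfct_add_one (by omega)]
      simp only [eval_sub, eval_C, eval_X]
      push_cast
      ring

lemma eval_factorialQuotient_of_lt {v t : ℤ} (n : ℕ) (ht : v < t) :
    (factorialQuotient v n).eval (t : ℚ) =
      (-1) ^ n * (zfct (t - v - 1) / zfct (t - (v + n) - 1)) := by
  induction n with
  | zero =>
    simp [factorialQuotient, div_self (zfct_ne_zero (show 0 ≤ t - v - 1 by omega))]
  | succ n ih =>
    rw [factorialQuotient_succ, eval_mul, ih]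
    simp only [eval_sub, eval_C, eval_X]
    rcases lt_trichotomy t (v + n + 1) with h | h | h
    · rw [zfct_of_neg (n := t - (v + n) - 1) (by omega),
        zfct_of_neg (n := t - (v + (n + 1 : ℕ)) - 1) (by push_cast; omega)]
      simp
    · rw [zfct_of_neg (n := t - (v + (n + 1 : ℕ)) - 1) (by push_cast; omega)]
      subst h
      push_cast
      ring
    · have h0 : 0 ≤ t - (v + (n + 1 : ℕ)) - 1 := by push_cast; omega
      have h1 : t - (v + n) - 1 = t - (v + (n + 1 : ℕ)) - 1 + 1 := by push_cast; ring
      have h2 : ((t - (v + (n + 1 : ℕ)) - 1 : ℤ) : ℚ) + 1 ≠ 0 := by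
        exact_mod_cast (by omega : t - (v + (n + 1 : ℕ)) - 1 + 1 ≠ 0)
      rw [h1, zfct_add_one h0]
      have h3 := zfct_ne_zero h0
      generalize zfct (t - (v + (n + 1 : ℕ)) - 1) = y at h3 ⊢
      have h4 : (v : ℚ) + 1 + n - t = -(((t - (v + (n + 1 : ℕ)) - 1 : ℤ) : ℚ) + 1) := by
        push_cast; ring
      rw [h4]
      generalize ((t - (v + (n + 1 : ℕ)) - 1 : ℤ) : ℚ) + 1 = w at h2 ⊢
      field_simp
      ring

/-- The quotient `(u + x)! / (v + x)!` of factorials as a polynomial in `x`. -/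
lemma exists_polynomial_factorial_add_div {u v : ℤ} (hvu : v ≤ u) (hu : 0 ≤ u) :
    ∃ P : ℚ[X], (P.natDegree : ℤ) ≤ u - v ∧
      ∀ x : ℕ, P.eval (x : ℚ) = zfct (u + x) / zfct (v + x) := by
  obtain ⟨n, rfl⟩ := Int.le.dest hvu
  refine ⟨(factorialQuotient v n).comp (-X), ?_, fun x => ?_⟩
  · have := natDegree_factorialQuotient_le v n
    rw [natDegree_comp, natDegree_neg, natDegree_X]
    push_cast
    omega
  · have := eval_factorialQuotient_of_le (v := v) (t := -x) (n := n) (by omega)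
    simpa using this

lemma sum_alternating_polynomial_eq_zero {P : ℚ[X]} {n : ℕ} (hP : P.natDegree < n) :
    ∑ t ∈ range (n + 1), (-1) ^ t * (P.eval (t : ℚ) / (zfct t * zfct (n - t))) = 0 := by
  have key := congrFun (fwdDiff_iter_eq_zero_of_degree_lt hP) 0
  rw [fwdDiff_iter_eq_sum_shift] at key
  have h : ∀ t ∈ range (n + 1), (-1) ^ t * (P.eval (t : ℚ) / (zfct t * zfct (n - t))) =
      (-1) ^ n / n.factorial *
        (((-1 : ℤ) ^ (n - t) * n.choose t) • P.eval ((0 : ℚ) + t • 1)) := by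
    intro t ht
    have htn : t ≤ n := by simpa [Nat.lt_succ_iff] using ht
    rw [show (n : ℤ) - t = (n - t : ℕ) by omega, zfct_natCast, zfct_natCast, zsmul_eq_mul]
    push_cast
    rw [Nat.cast_choose ℚ htn]
    have h1 : (n.factorial : ℚ) ≠ 0 := by positivity
    have h2 : ((-1) ^ n * (-1) ^ (n - t) : ℚ) = (-1) ^ t := by
      rw [← pow_add, show n + (n - t) = t + 2 * (n - t) by omega, pow_add, pow_mul]
      simp
    rw [← h2]
    simp only [zero_add, nsmul_eq_mul, mul_one]
    field_simp
  rw [sum_congr rfl h, ← mul_sum, key]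
  simp

/-- Up to the excluded interval, the sum of a quotient of factorials and of its reflection
is interpolated by a polynomial. -/
lemma exists_polynomial_factorial_quotient_add_reflection {D E L M : ℤ}
    (hED : E ≤ D) (hEM : E ≤ M) (hLD : L ≤ D) :
    ∃ Q : ℚ[X], (Q.natDegree : ℤ) ≤ D - E + M - L ∧ ∀ t : ℤ, ¬ (M < t ∧ t ≤ L) →
      zfct (D - t) * zfct (M - t) / (zfct (E - t) * zfct (L - t)) +
        (-1) ^ (D - E + M - L) * (zfct (t - E - 1) * zfct (t - L - 1) /
          (zfct (t - D - 1) * zfct (t - M - 1))) = Q.eval (t : ℚ) := by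
  have hsign (m n : ℕ) {j : ℤ} (hj : j = m + n) : (-1 : ℚ) ^ j = (-1) ^ m * (-1) ^ n := by
    rw [hj, ← pow_add]
    exact_mod_cast rfl
  rcases le_or_gt L M with hLM | hML
  · obtain ⟨m, rfl⟩ := Int.le.dest hED
    obtain ⟨n, rfl⟩ := Int.le.dest hLM
    refine ⟨factorialQuotient E m * factorialQuotient L n, ?_, fun t _ => ?_⟩
    · have h1 := natDegree_factorialQuotient_le E m
      have h2 := natDegree_factorialQuotient_le L n
      have h3 := natDegree_mul_le (p := factorialQuotient E m) (q := factorialQuotient L n)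
      omega
    · rw [eval_mul, hsign m n (by ring)]
      rcases le_or_gt t E with h | h
      · rw [eval_factorialQuotient_of_le (by omega), eval_factorialQuotient_of_le (by omega),
          zfct_of_neg (n := t - E - 1) (by omega)]
        ring
      · rw [zfct_of_neg (n := E - t) (by omega)]
        rcases le_or_gt t L with h' | h'
        · rw [eval_factorialQuotient_of_le (v := E) (by omega),
            zfct_of_neg (n := t - L - 1) (by omega), zfct_of_neg (n := E - t) (by omega)]
          simp
        · rw [eval_factorialQuotient_of_lt _ h, eval_factorialQuotient_of_lt _ h']
          ring
  · obtain ⟨m, rfl⟩ := Int.le.dest hEM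
    obtain ⟨n, rfl⟩ := Int.le.dest hLD
    refine ⟨factorialQuotient E m * factorialQuotient L n, ?_, fun t ht => ?_⟩
    · have h1 := natDegree_factorialQuotient_le E m
      have h2 := natDegree_factorialQuotient_le L n
      have h3 := natDegree_mul_le (p := factorialQuotient E m) (q := factorialQuotient L n)
      omega
    · rw [eval_mul, hsign m n (by ring)]
      rcases le_or_gt t (E + m) with h | h
      · rw [eval_factorialQuotient_of_le h, eval_factorialQuotient_of_le (by omega),
          zfct_of_neg (n := t - (E + m) - 1) (by omega)]
        ring
      · have h' : L < t := by omega
        rw [eval_factorialQuotient_of_lt _ (by omega : E < t),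
          eval_factorialQuotient_of_lt _ h', zfct_of_neg (n := L - t) (by omega)]
        ring

/-- In the excluded interval `M < t ≤ L`, the sum over `z` alone vanishes. -/
lemma sum_factorial_weight_eq_zero {p₁ p₂ H p₅ β γ L M t : ℤ} {p₄ : ℕ}
    (hp₂ : p₂ = β + L) (h1 : 0 ≤ p₁) (h2 : 0 ≤ p₂) (hγ : γ ≤ p₁) (h5 : p₅ ≤ H)
    (h4 : p₄ ≤ H) (hdeg : p₄ = L + H - p₅ + p₁ - γ - M) (hM : M < t) (hL : t ≤ L) :
    ∑ z ∈ range (p₄ + 1), (-1) ^ z * (zfct (p₁ + z) * zfct (p₂ + z) * zfct (H - z) /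
      (zfct z * zfct (p₄ - z) * zfct (p₅ - z) * zfct (γ + z))) / zfct (β + z + t) = 0 := by
  obtain ⟨P, hP, hP'⟩ := exists_polynomial_factorial_add_div hγ h1
  obtain ⟨R, hR, hR'⟩ := exists_polynomial_factorial_add_div (by omega : β + t ≤ p₂) h2
  obtain ⟨n, rfl⟩ := Int.le.dest h5
  have hn := natDegree_factorialQuotient_le p₅ n
  have hlt : (P * R * factorialQuotient p₅ n).natDegree < p₄ := by
    have h3 := natDegree_mul_le (p := P * R) (q := factorialQuotient p₅ n)
    have h6 := natDegree_mul_le (p := P) (q := R)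
    omega
  rw [← sum_alternating_polynomial_eq_zero hlt]
  refine sum_congr rfl fun z hz => ?_
  have hz' : z ≤ p₄ := by simpa [Nat.lt_succ_iff] using hz
  have hq := eval_factorialQuotient_of_le (v := p₅) (t := z) (n := n) (by omega)
  rw [Int.cast_natCast] at hq
  rw [eval_mul, eval_mul, hP', hR', hq, add_right_comm β t]
  ring

lemma sum_factorial_reflection_eq_zero {Q : ℚ[X]} {α v δ : ℤ} {N : ℕ}
    (hv : v ≤ α) (hα : 0 ≤ α) (hQ : (Q.natDegree : ℤ) ≤ δ) (hN : δ + (α - v) < N) :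
    ∑ t ∈ range (N + 1), (-1) ^ t * (zfct (α + t) / (zfct t * zfct (N - t) * zfct (v + t)) *
      Q.eval (t : ℚ)) = 0 := by
  obtain ⟨R, hR, hR'⟩ := exists_polynomial_factorial_add_div hv hα
  have hlt : (R * Q).natDegree < N := by
    have := natDegree_mul_le (p := R) (q := Q)
    omega
  rw [← sum_alternating_polynomial_eq_zero hlt]
  refine sum_congr rfl fun t _ => ?_
  rw [eval_mul, hR']
  ring

theorem sum_sum_factorial_reflection_eq_zero {p₁ p₂ H p₅ α β γ D E L M : ℤ} {p₄ N : ℕ}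
    (hα : α = β + p₅) (hp₂ : p₂ = β + L) (hα0 : 0 ≤ α) (h1 : 0 ≤ p₁) (h2 : 0 ≤ p₂)
    (hγ : γ ≤ p₁) (h5 : p₅ ≤ H) (h4 : p₄ ≤ H) (hED : E ≤ D) (hEM : E ≤ M) (hLD : L ≤ D)
    (hdeg : p₄ = L + H - p₅ + p₁ - γ - M) (hN : N = D - E + M - L + p₅ + γ + 1) :
    ∑ z ∈ range (p₄ + 1), ∑ t ∈ range (N + 1),
      (-1) ^ z * (zfct (p₁ + z) * zfct (p₂ + z) * zfct (H - z) /
        (zfct z * zfct (p₄ - z) * zfct (p₅ - z) * zfct (γ + z))) *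
      ((-1) ^ t * (zfct (α + t) / (zfct t * zfct (N - t) * zfct (β + z + t)) *
        (zfct (D - t) * zfct (M - t) / (zfct (E - t) * zfct (L - t)) +
          (-1) ^ (D - E + M - L) * (zfct (t - E - 1) * zfct (t - L - 1) /
            (zfct (t - D - 1) * zfct (t - M - 1)))))) = 0 := by
  obtain ⟨Q, hQ, hQ'⟩ := exists_polynomial_factorial_quotient_add_reflection hED hEM hLD
  have hpoly : ∑ z ∈ range (p₄ + 1), ∑ t ∈ range (N + 1),
      (-1) ^ z * (zfct (p₁ + z) * zfct (p₂ + z) * zfct (H - z) /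
        (zfct z * zfct (p₄ - z) * zfct (p₅ - z) * zfct (γ + z))) *
      ((-1) ^ t * (zfct (α + t) / (zfct t * zfct (N - t) * zfct (β + z + t)) *
        Q.eval (t : ℚ))) = 0 := by
    refine sum_eq_zero fun z _ => ?_
    rw [← mul_sum]
    rcases lt_or_ge (γ + z) 0 with h | h
    · simp [zfct_of_neg h]
    rcases lt_or_ge (p₅ - z) 0 with h' | h'
    · simp [zfct_of_neg h']
    rw [sum_factorial_reflection_eq_zero (by omega) hα0 hQ (by omega), mul_zero]
  rw [← hpoly, sum_comm]
  conv_rhs => rw [sum_comm]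
  refine sum_congr rfl fun t _ => ?_
  by_cases ht : M < (t : ℤ) ∧ (t : ℤ) ≤ L
  · have hzero := sum_factorial_weight_eq_zero hp₂ h1 h2 hγ h5 h4 hdeg ht.1 ht.2
    have hfactor (x : ℚ) : ∑ z ∈ range (p₄ + 1),
        (-1) ^ z * (zfct (p₁ + z) * zfct (p₂ + z) * zfct (H - z) /
          (zfct z * zfct (p₄ - z) * zfct (p₅ - z) * zfct (γ + z))) *
        ((-1) ^ t * (zfct (α + t) / (zfct t * zfct (N - t) * zfct (β + z + t)) * x)) = 0 := by
      rw [← mul_zero ((-1) ^ t * (zfct (α + t) / (zfct t * zfct (N - t)) * x)), ← hzero,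
        mul_sum]
      refine sum_congr rfl fun z _ => ?_
      ring
    rw [hfactor, hfactor]
  · simp only [hQ' t ht, Int.cast_natCast]

theorem sum_sum_factorial_eq_sum_sum_reflection {p₁ p₂ H p₅ α β γ D E L M : ℤ} {p₄ N : ℕ}
    (hα : α = β + p₅) (hp₂ : p₂ = β + L) (hα0 : 0 ≤ α) (h1 : 0 ≤ p₁) (h2 : 0 ≤ p₂)
    (hγ : γ ≤ p₁) (h5 : p₅ ≤ H) (h4 : p₄ ≤ H) (hED : E ≤ D) (hEM : E ≤ M) (hLD : L ≤ D)
    (hdeg : p₄ = L + H - p₅ + p₁ - γ - M) (hN : N = D - E + M - L + p₅ + γ + 1) :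
    ∑ z ∈ range (p₄ + 1), ∑ t ∈ range (N + 1), (-1) ^ (z + t) *
      (zfct (p₁ + z) * zfct (p₂ + z) * zfct (H - z) /
        (zfct z * zfct (p₄ - z) * zfct (p₅ - z) * zfct (γ + z))) *
      (zfct (α + t) / (zfct t * zfct (N - t) * zfct (β + z + t)) *
        (zfct (D - t) * zfct (M - t) / (zfct (E - t) * zfct (L - t)))) =
    (-1) ^ (D - E + M - L + N + 1) * ∑ z ∈ range (p₄ + 1), ∑ t ∈ range (N + 1),
      (-1) ^ (z + t) *
      (zfct (p₁ + z) * zfct (p₂ + z) * zfct (H - z) /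
        (zfct z * zfct (p₄ - z) * zfct (p₅ - z) * zfct (γ + z))) *
      (zfct (α + (N - t)) / (zfct (N - t) * zfct t * zfct (β + z + (N - t))) *
        (zfct (N - t - E - 1) * zfct (N - t - L - 1) /
          (zfct (N - t - D - 1) * zfct (N - t - M - 1)))) := by
  have key := sum_sum_factorial_reflection_eq_zero hα hp₂ hα0 h1 h2 hγ h5 h4 hED hEM hLD hdeg hN
  have hflip (z : ℕ) : ∑ t ∈ range (N + 1), (-1) ^ (z + t) *
      (zfct (p₁ + z) * zfct (p₂ + z) * zfct (H - z) /
        (zfct z * zfct (p₄ - z) * zfct (p₅ - z) * zfct (γ + z))) *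
      (zfct (α + (N - t)) / (zfct (N - t) * zfct t * zfct (β + z + (N - t))) *
        (zfct (N - t - E - 1) * zfct (N - t - L - 1) /
          (zfct (N - t - D - 1) * zfct (N - t - M - 1)))) =
      ∑ t ∈ range (N + 1), (-1) ^ N * ((-1) ^ z *
      (zfct (p₁ + z) * zfct (p₂ + z) * zfct (H - z) /
        (zfct z * zfct (p₄ - z) * zfct (p₅ - z) * zfct (γ + z))) *
      ((-1) ^ t * (zfct (α + t) / (zfct t * zfct (N - t) * zfct (β + z + t)) *
        (zfct (t - E - 1) * zfct (t - L - 1) / (zfct (t - D - 1) * zfct (t - M - 1)))))) := by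
    rw [← sum_flip]
    refine sum_congr rfl fun t ht => ?_
    have htN : t ≤ N := by simpa [Nat.lt_succ_iff] using ht
    have hs : (-1 : ℚ) ^ (z + (N - t)) = (-1) ^ N * ((-1) ^ z * (-1) ^ t) := by
      rw [pow_add, show ((-1 : ℚ) ^ N) = (-1) ^ t * (-1) ^ (N - t) by
        rw [← pow_add]; congr 1; omega]
      have h2 : ((-1 : ℚ) ^ t) * (-1) ^ t = 1 := by rw [← mul_pow]; norm_num
      linear_combination (-(-1) ^ z * (-1) ^ (N - t)) * h2
    simp only [show ((N - t : ℕ) : ℤ) = N - t by omega, sub_sub_cancel, hs]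
    ring
  have hs : (-1 : ℚ) ^ (D - E + M - L + N + 1) * (-1) ^ N = -(-1) ^ (D - E + M - L) := by
    have h0 : (-1 : ℚ) ≠ 0 := by norm_num
    rw [zpow_add₀ h0, zpow_add₀ h0, zpow_natCast, zpow_one]
    have h2 : ((-1 : ℚ) ^ N) * (-1) ^ N = 1 := by rw [← mul_pow]; norm_num
    linear_combination (-(-1) ^ (D - E + M - L)) * h2
  rw [sum_congr rfl fun z _ => hflip z, mul_sum, ← sub_eq_zero, ← key, ← sum_sub_distrib]
  refine sum_congr rfl fun z _ => ?_
  rw [mul_sum, ← sum_sub_distrib]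
  refine sum_congr rfl fun t _ => ?_
  rw [← mul_assoc ((-1 : ℚ) ^ (D - E + M - L + N + 1)), hs]
  ring

lemma mul_sum_sum_eq_mul_sum_sum {s t : Finset ℕ} {F G f g : ℕ → ℕ → ℚ} {p q r x y : ℚ}
    (h : ∑ i ∈ s, ∑ j ∈ t, f i j = r * ∑ i ∈ s, ∑ j ∈ t, g i j)
    (hF : ∀ i j, F i j = p * f i j) (hG : ∀ i j, G i j = q * g i j) (hr : x * p * r = y * q) :
    x * ∑ i ∈ s, ∑ j ∈ t, F i j = y * ∑ i ∈ s, ∑ j ∈ t, G i j := by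
  simp only [hF, hG, ← mul_sum]
  rw [h]
  linear_combination (∑ i ∈ s, ∑ j ∈ t, g i j) * hr

lemma finsum_finsum_finsum_eq_sum_range {F : ℕ → ℕ → ℕ → ℚ} (p q r : ℕ)
    (hp : ∀ i j l, p < i → F i j l = 0) (hq : ∀ i j l, q < j → F i j l = 0)
    (hr : ∀ i j l, r < l → F i j l = 0) :
    ∑ᶠ i, ∑ᶠ j, ∑ᶠ l, F i j l =
      ∑ l ∈ range (r + 1), ∑ i ∈ range (p + 1), ∑ j ∈ range (q + 1), F i j l := by
  rw [finsum_nat_eq_sum_range p fun i hi => by simp [hp i _ _ hi], sum_comm]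
  refine sum_congr rfl fun i _ => ?_
  rw [finsum_nat_eq_sum_range q fun j hj => by simp [hq i j _ hj], sum_comm]
  refine sum_congr rfl fun j _ => ?_
  rw [finsum_nat_eq_sum_range r fun l hl => hr i j l hl]

set_option maxHeartbeats 1000000 in
/-- Equality of the Ališauskas–Jucys triple-sum formula for the SU(2) 9j
coefficient `{a b e; c d f; h k g}` and the first new triple-sum formula of the
paper. -/
theorem nineJ_tripleSum_A_eq_B (a b c d e f g h k : ℚ)
    (ha : IsNNHalfInt a) (hb : IsNNHalfInt b) (hc : IsNNHalfInt c)
    (hd : IsNNHalfInt d) (he : IsNNHalfInt e) (hf : IsNNHalfInt f)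
    (hg : IsNNHalfInt g) (hh : IsNNHalfInt h) (hk : IsNNHalfInt k)
    (t1 : Triad a b e) (t2 : Triad c d f) (t3 : Triad h k g)
    (t4 : Triad a c h) (t5 : Triad b d k) (t6 : Triad e f g) :
    neg1pw (c + h - a) * sumSA a b c d e f g h k =
      neg1pw (e - f - h + k) * sumSB a b c d e f g h k := by
  obtain ⟨⟨m₁, h₁⟩, ⟨m₂, h₂⟩, ⟨m₃, h₃⟩⟩ := t1
  obtain ⟨⟨m₄, h₄⟩, ⟨m₅, h₅⟩, ⟨m₆, h₆⟩⟩ := t2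
  obtain ⟨⟨m₇, h₇⟩, ⟨m₈, h₈⟩, ⟨m₉, h₉⟩⟩ := t3
  obtain ⟨⟨n₁, i₁⟩, ⟨n₂, i₂⟩, ⟨n₃, i₃⟩⟩ := t4
  obtain ⟨⟨n₄, i₄⟩, ⟨n₅, i₅⟩, ⟨n₆, i₆⟩⟩ := t5
  obtain ⟨⟨n₇, i₇⟩, ⟨n₈, i₈⟩, ⟨n₉, i₉⟩⟩ := t6
  have r₁ : m₁ + m₃ = n₄ + n₅ := Nat.cast_injective (R := ℚ) (by push_cast; linarith)
  have r₂ : m₄ + m₅ = n₁ + n₃ := Nat.cast_injective (R := ℚ) (by push_cast; linarith)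
  have r₃ : m₄ + m₆ = n₄ + n₆ := Nat.cast_injective (R := ℚ) (by push_cast; linarith)
  have r₄ : m₁ + m₂ = n₁ + n₂ := Nat.cast_injective (R := ℚ) (by push_cast; linarith)
  have r₅ : m₂ + m₃ = n₇ + n₈ := Nat.cast_injective (R := ℚ) (by push_cast; linarith)
  have r₆ : m₅ + m₆ = n₇ + n₉ := Nat.cast_injective (R := ℚ) (by push_cast; linarith)
  have r₇ : m₈ + m₉ = n₈ + n₉ := Nat.cast_injective (R := ℚ) (by push_cast; linarith)
  have r₈ : m₇ + m₈ = n₂ + n₃ := Nat.cast_injective (R := ℚ) (by push_cast; linarith)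
  have r₉ : m₇ + m₉ = n₅ + n₆ := Nat.cast_injective (R := ℚ) (by push_cast; linarith)
  have e1 (x : ℕ) : fct (g - h + k + x) = zfct (m₉ + x) :=
    fct_intCast (by push_cast; linarith)
  have e2 (x : ℕ) : fct (a + c - h + x) = zfct (n₁ + x) :=
    fct_intCast (by push_cast; linarith)
  have e3 (x : ℕ) : fct (2 * h - x) = zfct (n₂ + n₃ - x) :=
    fct_intCast (by push_cast; linarith)
  have e4 (x : ℕ) : fct (g + h - k - x) = zfct (m₈ - x) :=
    fct_intCast (by push_cast; linarith)
  have e5 (x : ℕ) : fct (c - a + h - x) = zfct (n₃ - x) :=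
    fct_intCast (by push_cast; linarith)
  have e6 (x : ℕ) : fct (c + h - a - x) = zfct (n₃ - x) :=
    fct_intCast (by push_cast; linarith)
  have e7 (x : ℕ) : fct (2 * d - x) = zfct (n₄ + n₆ - x) :=
    fct_intCast (by push_cast; linarith)
  have e8 (x : ℕ) : fct (c - d + f + x) = zfct (m₅ + x) :=
    fct_intCast (by push_cast; linarith)
  have e9 (x : ℕ) : fct (d - b + k - x) = zfct (n₆ - x) :=
    fct_intCast (by push_cast; linarith)
  have e10 (x : ℕ) : fct (c + d - f - x) = zfct (m₄ - x) :=
    fct_intCast (by push_cast; linarith)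
  have e11 (x : ℕ) : fct (b + d + k + 1 - x) = zfct (((n₄ + n₅ + n₆ + 1 : ℕ) : ℤ) - x) :=
    fct_intCast (by push_cast; linarith)
  have e12 (x : ℕ) : fct (b + e - a + x) = zfct (m₃ + x) :=
    fct_intCast (by push_cast; linarith)
  have e13 (x : ℕ) : fct (e - f + g + x) = zfct (n₈ + x) :=
    fct_intCast (by push_cast; linarith)
  have e14 (x : ℕ) : fct (a + b - e - x) = zfct (m₁ - x) :=
    fct_intCast (by push_cast; linarith)
  have e15 (x : ℕ) : fct (f + g - e - x) = zfct (n₉ - x) :=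
    fct_intCast (by push_cast; linarith)
  have e16 (x : ℕ) : fct (2 * e + 1 + x) = zfct (m₂ + m₃ + 1 + x) :=
    fct_intCast (by push_cast; linarith)
  have e17 (x : ℕ) : fct (2 * b - x) = zfct (((n₄ + n₅ + n₆ + 1 : ℕ) : ℤ) - x - n₆ - 1) :=
    fct_intCast (by push_cast; linarith)
  have e18 (x : ℕ) : fct (b - c + f + k - x) =
      zfct (((n₄ + n₅ + n₆ + 1 : ℕ) : ℤ) - x - m₄ - 1) :=
    fct_intCast (by push_cast; linarith)
  have e19 (x : ℕ) : fct (b + c + f + k + 1 - x) =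
      zfct (m₅ + (((n₄ + n₅ + n₆ + 1 : ℕ) : ℤ) - x)) :=
    fct_intCast (by push_cast; linarith)
  have e20 (x : ℕ) : fct (b - d + k - x) =
      zfct (((n₄ + n₅ + n₆ + 1 : ℕ) : ℤ) - x - (n₄ + n₆) - 1) :=
    fct_intCast (by push_cast; linarith)
  have e21 (x y : ℕ) : fct (a + d - e + k - x - y) = zfct (m₁ + n₆ - y - x) :=
    fct_intCast (by push_cast; linarith)
  have e22 (x y : ℕ) : fct (a - d + f - h + x + y) = zfct (n₁ - m₄ + x + y) :=
    fct_intCast (by push_cast; linarith)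
  have e23 (x y : ℕ) : fct (e - f - h + k + x + y) = zfct (n₈ - m₈ + y + x) :=
    fct_intCast (by push_cast; linarith)
  have e24 (x y : ℕ) : fct (e + k - f - h + x + y) = zfct (n₈ - m₈ + y + x) :=
    fct_intCast (by push_cast; linarith)
  have e25 (x y : ℕ) : fct (b + e - a - x + y) =
      zfct (((n₄ + n₅ + n₆ + 1 : ℕ) : ℤ) - x - (m₁ + n₆ - y) - 1) :=
    fct_intCast (by push_cast; linarith)
  have e26 (x y : ℕ) : fct (a + b + f - h + k + 1 + x - y) =
      zfct (n₁ - m₄ + x + (((n₄ + n₅ + n₆ + 1 : ℕ) : ℤ) - y)) :=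
    fct_intCast (by push_cast; linarith)
  have q0 (x : ℕ) : (x.factorial : ℚ) = zfct x := (zfct_natCast x).symm
  unfold sumSA sumSB
  simp only [q0,
    e1, e2, e3, e4, e5, e6, e7, e8, e9, e10, e11, e12, e13, e14, e15, e16, e17, e18,
    e19, e20, e21, e22, e23, e24, e25, e26]
  rw [neg1pw_intCast (n := n₃) (by push_cast; linarith),
    neg1pw_intCast (n := n₈ - m₈) (by push_cast; linarith)]
  rw [finsum_finsum_finsum_eq_sum_range m₈ (n₄ + n₅ + n₆ + 1) (min m₁ n₉) (fun i j l hi => ?_)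
      (fun i j l hj => ?_) (fun i j l hl => ?_),
    finsum_finsum_finsum_eq_sum_range m₈ (n₄ + n₅ + n₆ + 1) (min m₁ n₉) (fun i j l hi => ?_)
      (fun i j l hj => ?_) (fun i j l hl => ?_)]
  · rw [mul_sum, mul_sum]
    refine sum_congr rfl fun s hs => ?_
    have hs' : s ≤ m₁ ∧ s ≤ n₉ := by simpa [Nat.lt_succ_iff] using hs
    have key := sum_sum_factorial_eq_sum_sum_reflection (p₁ := m₉) (p₂ := n₁) (H := n₂ + n₃)
      (p₅ := n₃) (α := m₅) (β := n₁ - m₄) (γ := n₈ - m₈ + s) (D := n₄ + n₆) (E := n₆)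
      (L := m₄) (M := m₁ + n₆ - s) (p₄ := m₈) (N := n₄ + n₅ + n₆ + 1)
      (by omega) (by omega) (by omega) (by omega) (by omega) (by omega) (by omega) (by omega)
      (by omega) (by omega) (by omega) (by omega) (by push_cast; omega)
    have h0 : (-1 : ℚ) ≠ 0 := by norm_num
    have hsign : (-1 : ℚ) ^ (n₃ : ℤ) * (-1) ^ s *
        (-1) ^ ((n₄ : ℤ) + n₆ - n₆ + (m₁ + n₆ - s) - m₄ + (n₄ + n₅ + n₆ + 1 : ℕ) + 1) = (-1) ^ ((n₈ : ℤ) - m₈) := by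
      rw [← zpow_natCast, ← zpow_add₀ h0, ← zpow_add₀ h0]
      have hexp : (n₃ : ℤ) + s + ((n₄ : ℤ) + n₆ - n₆ + (m₁ + n₆ - s) - m₄ +
          (n₄ + n₅ + n₆ + 1 : ℕ) + 1) =
          n₈ - m₈ + 2 * ((n₄ + n₅ + n₆ + 1 : ℕ) - (n₈ - m₈)) := by
        push_cast
        omega
      rw [hexp, zpow_add₀ h0, (even_two_mul _).neg_one_zpow, mul_one]
    refine mul_sum_sum_eq_mul_sum_sum key
      (p := (-1) ^ s * (zfct (m₃ + s) * zfct (n₈ + s) /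
        (zfct s * zfct (m₁ - s) * zfct (n₉ - s) * zfct (m₂ + m₃ + 1 + s))))
      (q := zfct (m₃ + s) * zfct (n₈ + s) /
        (zfct s * zfct (m₁ - s) * zfct (n₉ - s) * zfct (m₂ + m₃ + 1 + s)))
      (fun i j => ?_) (fun i j => ?_) ?_
    · ring
    · ring
    · rw [← hsign]
      ring
  · simp only [zfct_of_neg (show (m₈ : ℤ) - i < 0 by omega),
      mul_zero, zero_mul, div_zero]
  · simp only [zfct_of_neg (show ((n₄ + n₅ + n₆ + 1 : ℕ) : ℤ) - j < 0 by omega),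
      mul_zero, zero_mul, div_zero]
  · rcases min_lt_iff.1 hl with hl | hl
    · simp only [zfct_of_neg (show (m₁ : ℤ) - l < 0 by omega),
      mul_zero, zero_mul, div_zero]
    · simp only [zfct_of_neg (show (n₉ : ℤ) - l < 0 by omega),
      mul_zero, zero_mul, div_zero]
  · simp only [zfct_of_neg (show (m₈ : ℤ) - i < 0 by omega),
      mul_zero, zero_mul, div_zero]
  · simp only [zfct_of_neg (show ((n₄ + n₅ + n₆ + 1 : ℕ) : ℤ) - j < 0 by omega),
      mul_zero, zero_mul, div_zero]
  · rcases min_lt_iff.1 hl with hl | hl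
    · simp only [zfct_of_neg (show (m₁ : ℤ) - l < 0 by omega),
      mul_zero, zero_mul, div_zero]
    · simp only [zfct_of_neg (show (n₉ : ℤ) - l < 0 by omega),
      mul_zero, zero_mul, div_zero]
end
end

section
/- Define the triple sums S_A = Σ_{z1,z2,z3} (−1)^(z1+z2+z3) · [(g−h+k+z1)!(a+c−h+z1)!(2h−z1)! / (z1!(g+h−k−z1)!(c−a+h−z1)!)] · [(2d−z2)!(c−d+f+z2)! / (z2!(d−b+k−z2)!(c+d−f−z2)!(b+d+k+1−z2)!)] · [(b+e−a+z3)!(e−f+g+z3)! / (z3!(a+b−e−z3)!(f+g−e−z3)!(2e+1+z3)!)] · [(a+d−e+k−z2−z3)! / ((a−d+f−h+z1+z2)!(e−f−h+k+z1+z3)!)] and S_C = Σ_{z1,z2,z3} (−1)^(z1+z3) · [(a+c−g+k−z1)!(a+c+g+k+1−z1)!(2c−z1)! / (z1!(a+c−h−z1)!(a+c+h+1−z1)!)] · [(2d−z2)!(c−d+f+z2)! / (z2!(d−b+k−z2)!(c+d−f−z2)!(b+d+k+1−z2)!)] · [(a−b+f+g−z3)!(a+b+f+g+1−z3)!(2g−z3)!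 / (z3!(f+g−e−z3)!(e+f+g+1−z3)!)] · [1 / ((c−d+f−z1+z2)!(a−d+f+g−k+z2−z3)!(a+c+g+k+1−z1−z3)!)]. Then, under the triangle conditions of the 9j symbol, (−1)^(c+h−a) · N(a,b,e) · S_A = (−1)^(c−d+f) · N(a,c,h) · S_C (both exponents are integers). This expresses the equality of the Ališauskas–Jucys triple-sum formula for the SU(2) 9j coefficient {a b e; c d f; h k g} and the new triple-sum formula obtained from expansion (trsc) of the paper. -/
noncomputable section

/-- The triple sum `S_C` of the new triple-sum formula obtained from expansion
(trsc) of the paper. -/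
def sumSC (a b c d e f g h k : ℚ) : ℚ :=
  ∑ᶠ z1 : ℕ, ∑ᶠ z2 : ℕ, ∑ᶠ z3 : ℕ,
    (-1 : ℚ) ^ (z1 + z3) *
      (fct (a + c - g + k - z1) * fct (a + c + g + k + 1 - z1) * fct (2 * c - z1) /
        ((Nat.factorial z1 : ℚ) * fct (a + c - h - z1) * fct (a + c + h + 1 - z1))) *
      (fct (2 * d - z2) * fct (c - d + f + z2) /
        ((Nat.factorial z2 : ℚ) * fct (d - b + k - z2) * fct (c + d - f - z2) *
          fct (b + d + k + 1 - z2))) *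
      (fct (a - b + f + g - z3) * fct (a + b + f + g + 1 - z3) * fct (2 * g - z3) /
        ((Nat.factorial z3 : ℚ) * fct (f + g - e - z3) * fct (e + f + g + 1 - z3))) *
      (1 / (fct (c - d + f - z1 + z2) * fct (a - d + f + g - k + z2 - z3) *
        fct (a + c + g + k + 1 - z1 - z3)))

/-- The factorial of an integer, extended by `0` to negative integers. -/
def facZ (n : ℤ) : ℚ := if 0 ≤ n then (n.toNat.factorial : ℚ) else 0

/-- The reciprocal factorial of an integer, which is `0` at negative integers. -/
def rfacZ (n : ℤ) : ℚ := (facZ n)⁻¹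

lemma facZ_natCast (n : ℕ) : facZ n = n.factorial := by simp [facZ]

lemma facZ_of_neg {n : ℤ} (h : n < 0) : facZ n = 0 := by simp [facZ, h]

lemma rfacZ_of_neg {n : ℤ} (h : n < 0) : rfacZ n = 0 := by simp [rfacZ, facZ_of_neg h]

lemma facZ_ne_zero {n : ℤ} (h : 0 ≤ n) : facZ n ≠ 0 := by
  simp [facZ, h, Nat.factorial_ne_zero]

lemma facZ_mul_rfacZ {n : ℤ} (h : 0 ≤ n) : facZ n * rfacZ n = 1 :=
  mul_inv_cancel₀ (facZ_ne_zero h)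

lemma facZ_add_one {n : ℤ} (h : n ≠ -1) : facZ (n + 1) = (n + 1) * facZ n := by
  rcases lt_or_ge n 0 with hn | hn
  · rw [facZ_of_neg hn, facZ_of_neg (by omega), mul_zero]
  · lift n to ℕ using hn
    rw [facZ_natCast, ← Nat.cast_succ, facZ_natCast, Nat.factorial_succ]
    push_cast; ring

lemma rfacZ_sub_one (n : ℤ) : rfacZ (n - 1) = n * rfacZ n := by
  rcases lt_trichotomy n 0 with hn | rfl | hn
  · rw [rfacZ_of_neg hn, rfacZ_of_neg (by omega), mul_zero]
  · simp [rfacZ_of_neg]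
  · have h := facZ_add_one (n := n - 1) (by omega)
    rw [sub_add_cancel] at h
    have hn' : (n : ℚ) ≠ 0 := by exact_mod_cast hn.ne'
    rw [rfacZ, rfacZ, h]
    push_cast
    rw [sub_add_cancel, mul_inv, mul_inv_cancel_left₀ hn']

lemma facZ_zero : facZ 0 = 1 := by simp [facZ]

lemma rfacZ_zero : rfacZ 0 = 1 := by simp [rfacZ, facZ_zero]

/-- The Vandermonde sum with reciprocal factorials. -/
def vanderSum (q B : ℕ) (C : ℤ) : ℚ :=
  ∑ z ∈ Finset.range (B + 1),
    (-1) ^ z * facZ (B + q - z) * rfacZ z * rfacZ (B - z) * rfacZ (C - z)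

lemma vanderSum_zero_left (q : ℕ) (C : ℤ) : vanderSum q 0 C = facZ q * rfacZ C := by
  simp [vanderSum, rfacZ_zero]

lemma vanderSum_zero_right (q B : ℕ) : vanderSum q B 0 = facZ (B + q) * rfacZ B := by
  rw [vanderSum, Finset.sum_eq_single 0]
  · simp [rfacZ_zero]
  · intro z _ hz
    rw [rfacZ_of_neg (n := 0 - (z : ℤ)) (by omega), mul_zero]
  · simp

lemma mul_vanderSum_succ (q B : ℕ) (C : ℤ) :
    C * vanderSum q (B + 1) C = vanderSum q (B + 1) (C - 1) - vanderSum q B (C - 1) := by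
  have key : vanderSum q (B + 1) (C - 1) - C * vanderSum q (B + 1) C
      = vanderSum q B (C - 1) := by
    simp only [vanderSum]
    rw [Finset.mul_sum, ← Finset.sum_sub_distrib, Finset.sum_range_succ']
    rw [show rfacZ (C - 1 - ((0 : ℕ) : ℤ)) = C * rfacZ C by simp [rfacZ_sub_one]]
    simp only [Nat.cast_zero, sub_zero]
    rw [add_eq_left.mpr (by ring)]
    refine Finset.sum_congr rfl fun z _ => ?_
    have h1 := rfacZ_sub_one (C - (z + 1 : ℕ))
    have h2 := rfacZ_sub_one (z + 1 : ℕ)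
    rw [show C - 1 - ((z + 1 : ℕ) : ℤ) = C - (z + 1 : ℕ) - 1 by ring, h1,
      show C - 1 - (z : ℤ) = C - (z + 1 : ℕ) by push_cast; ring,
      show (z : ℤ) = ((z + 1 : ℕ) : ℤ) - 1 by push_cast; ring, h2]
    rw [show ((B + 1 : ℕ) : ℤ) + q - (z + 1 : ℕ) = B + q - (((z + 1 : ℕ) : ℤ) - 1) by
        push_cast; ring,
      show ((B + 1 : ℕ) : ℤ) - (z + 1 : ℕ) = B - (((z + 1 : ℕ) : ℤ) - 1) by push_cast; ring]
    push_cast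
    ring
  linarith

lemma vanderSum_of_le (q : ℕ) (C B : ℕ) (h : C ≤ B + q) :
    vanderSum q B C = facZ q * facZ (B + q - C) * rfacZ (q - C) * rfacZ B * rfacZ C := by
  induction C generalizing B with
  | zero =>
    simp only [Nat.cast_zero, sub_zero, vanderSum_zero_right, rfacZ_zero]
    linear_combination -facZ (B + q) * rfacZ B * facZ_mul_rfacZ (n := q) (by omega)
  | succ C ih =>
    cases B with
    | zero =>
      rw [vanderSum_zero_left]
      have := facZ_mul_rfacZ (n := (q : ℤ) - (C + 1 : ℕ)) (by omega)
      simp only [Nat.cast_zero, zero_add, rfacZ_zero]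
      linear_combination -facZ q * rfacZ (C + 1 : ℕ) * this
    | succ B =>
      have hr := mul_vanderSum_succ q B (C + 1 : ℕ)
      rw [show (((C + 1 : ℕ) : ℤ) - 1) = (C : ℤ) by push_cast; ring, ih _ (by omega),
        ih _ (by omega)] at hr
      have h1 := rfacZ_sub_one (C + 1 : ℕ)
      have h2 := rfacZ_sub_one (B + 1 : ℕ)
      have h3 := rfacZ_sub_one ((q : ℤ) - C)
      have h4 := facZ_add_one (n := (B : ℤ) + q - C) (by omega)
      rw [show (((C + 1 : ℕ) : ℤ) - 1) = (C : ℤ) by push_cast; ring] at h1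
      rw [show (((B + 1 : ℕ) : ℤ) - 1) = (B : ℤ) by push_cast; ring] at h2
      rw [show ((B + 1 : ℕ) : ℤ) + q - C = (B : ℤ) + q - C + 1 by push_cast; ring,
        h1, h2, h4] at hr
      rw [show ((B + 1 : ℕ) : ℤ) + q - (C + 1 : ℕ) = (B : ℤ) + q - C by push_cast; ring,
        show (q : ℤ) - (C + 1 : ℕ) = (q : ℤ) - C - 1 by push_cast; ring, h3]
      have hC : (((C + 1 : ℕ) : ℤ) : ℚ) ≠ 0 := by positivity
      apply mul_left_cancel₀ hC
      rw [hr]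
      push_cast
      ring

lemma vanderSum_of_gt (q K B : ℕ) :
    vanderSum q B (q + 1 + K) =
      (-1) ^ B * facZ q * facZ K * rfacZ (K - B) * rfacZ B * rfacZ (q + 1 + K) := by
  induction K generalizing B with
  | zero =>
    cases B with
    | zero => simp [vanderSum_zero_left, facZ_zero, rfacZ_zero]
    | succ B =>
      have := vanderSum_of_le q (q + 1) (B + 1) (by omega)
      push_cast at this ⊢
      rw [add_zero, this, rfacZ_of_neg (n := (q : ℤ) - (q + 1)) (by omega),
        rfacZ_of_neg (n := 0 - ((B : ℤ) + 1)) (by omega)]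
      ring
  | succ K ih =>
    cases B with
    | zero =>
      rw [vanderSum_zero_left]
      have := facZ_mul_rfacZ (n := (K + 1 : ℕ)) (by omega)
      simp only [Nat.cast_zero, sub_zero, rfacZ_zero, pow_zero]
      linear_combination -facZ q * rfacZ (q + 1 + (K + 1 : ℕ)) * this
    | succ B =>
      have hr := mul_vanderSum_succ q B (q + 1 + (K + 1 : ℕ))
      rw [show ((q : ℤ) + 1 + (K + 1 : ℕ) - 1) = q + 1 + K by push_cast; ring, ih, ih] at hr
      have h1 := rfacZ_sub_one ((q : ℤ) + 1 + (K + 1 : ℕ))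
      have h2 := rfacZ_sub_one (B + 1 : ℕ)
      have h3 := rfacZ_sub_one ((K : ℤ) - B)
      have h4 := facZ_add_one (n := (K : ℤ)) (by omega)
      rw [show ((q : ℤ) + 1 + (K + 1 : ℕ) - 1) = q + 1 + K by push_cast; ring] at h1
      rw [show (((B + 1 : ℕ) : ℤ) - 1) = (B : ℤ) by push_cast; ring] at h2
      rw [show ((K : ℤ) - (B + 1 : ℕ)) = (K : ℤ) - B - 1 by push_cast; ring, h1, h2, h3] at hr
      have h5 : facZ (K + 1 : ℕ) = ((K : ℤ) + 1) * facZ K := by push_cast; exact_mod_cast h4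
      rw [show ((K + 1 : ℕ) : ℤ) - (B + 1 : ℕ) = (K : ℤ) - B by push_cast; ring, h5]
      have hC : (((q : ℤ) + 1 + (K + 1 : ℕ) : ℤ) : ℚ) ≠ 0 := by
        have : (0 : ℤ) < (q : ℤ) + 1 + (K + 1 : ℕ) := by omega
        exact_mod_cast this.ne'
      apply mul_left_cancel₀ hC
      rw [hr]
      push_cast
      ring

lemma sum_range_eq_of_forall_zero {f : ℕ → ℚ} {M N : ℕ}
    (h : ∀ z, M ≤ z ∨ N ≤ z → f z = 0) :
    ∑ z ∈ Finset.range M, f z = ∑ z ∈ Finset.range N, f z := by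
  rcases le_total M N with hMN | hMN
  · exact Finset.sum_subset (Finset.range_mono hMN) fun z _ hz =>
      h z (Or.inl (by simpa using hz))
  · exact (Finset.sum_subset (Finset.range_mono hMN) fun z _ hz =>
      h z (Or.inr (by simpa using hz))).symm

/-- The terminating `₃F₂` sum arising from the boundary case of the double sum. -/
def hyperSum (K c i m l : ℕ) : ℚ :=
  ∑ z ∈ Finset.range (m + 1),
    (-1) ^ z * facZ (m + i - z) * facZ (c - z) * rfacZ z * rfacZ (m - z) *
      rfacZ (K + i + 1 - z) * rfacZ (c - l - z)

lemma hyperSum_recurrence (K c i m l : ℕ) :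
    ((K : ℚ) - l) * hyperSum K c i m (l + 1) + (m + 1) * (c - m) * hyperSum K c i (m + 1) l
      + (m - l) * (i - c + m + l + 1) * hyperSum K c i m l = 0 := by
  have ext : ∀ l', hyperSum K c i m l' = ∑ z ∈ Finset.range (m + 2),
      (-1) ^ z * facZ (m + i - z) * facZ (c - z) * rfacZ z * rfacZ (m - z) *
        rfacZ (K + i + 1 - z) * rfacZ (c - l' - z) := by
    intro l'
    rw [Finset.sum_range_succ, rfacZ_of_neg (n := (m : ℤ) - (m + 1 : ℕ)) (by omega)]
    simp [hyperSum]
  let S : ℕ → ℚ := fun z => -(-1) ^ z * facZ (m + i + 1 - z) * rfacZ (z - 1) *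
    rfacZ (K + i + 1 - z) * rfacZ (m + 1 - z) * facZ (c + 1 - z) * rfacZ (c - l - z)
  rw [ext, ext, hyperSum, Finset.mul_sum, Finset.mul_sum, Finset.mul_sum,
    ← Finset.sum_add_distrib, ← Finset.sum_add_distrib]
  rw [Finset.sum_congr rfl (g := fun z => S (z + 1) - S z), Finset.sum_range_sub]
  · simp only [S]
    rw [rfacZ_of_neg (n := (m : ℤ) + 1 - (m + 2 : ℕ)) (by push_cast; omega),
      rfacZ_of_neg (n := ((0 : ℕ) : ℤ) - 1) (by omega)]
    ring
  intro z hz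
  have hz : z < m + 2 := by simpa using hz
  simp only [S]
  rw [show (c : ℤ) - (l + 1 : ℕ) - z = c - l - z - 1 by push_cast; ring,
    show (c : ℤ) - l - (z + 1 : ℕ) = c - l - z - 1 by push_cast; ring]
  rcases lt_or_ge c z with hcz | hcz
  · rw [rfacZ_of_neg (n := (c : ℤ) - l - z) (by omega),
      rfacZ_of_neg (n := (c : ℤ) - l - z - 1) (by omega)]
    ring
  have h1 := rfacZ_sub_one ((c : ℤ) - l - z)
  have h2 := facZ_add_one (n := (c : ℤ) - z) (by omega)
  have h3 := rfacZ_sub_one (z : ℤ)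
  have h4 := rfacZ_sub_one ((K : ℤ) + i + 1 - z)
  have h5 := rfacZ_sub_one ((m : ℤ) + 1 - z)
  rw [show ((m : ℤ) + i + 1 - (z + 1 : ℕ)) = m + i - z by push_cast; ring,
    show (((z + 1 : ℕ) : ℤ) - 1) = z by push_cast; ring,
    show ((K : ℤ) + i + 1 - (z + 1 : ℕ)) = K + i + 1 - z - 1 by push_cast; ring,
    show ((m : ℤ) + 1 - (z + 1 : ℕ)) = m + 1 - z - 1 by push_cast; ring,
    show ((c : ℤ) + 1 - (z + 1 : ℕ)) = c - z by push_cast; ring,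
    show ((c : ℤ) + 1 - z) = c - z + 1 by ring,
    show ((m : ℤ) - z) = m + 1 - z - 1 by ring,
    show (((m + 1 : ℕ) : ℤ) + i - z) = m + i + 1 - z by push_cast; ring,
    show (((m + 1 : ℕ) : ℤ) - z) = m + 1 - z by push_cast; ring, h1, h2, h3, h4, h5]
  rcases Nat.lt_or_ge z (m + 1) with hzm | hzm
  · have h6 := facZ_add_one (n := (m : ℤ) + i - z) (by omega)
    rw [show ((m : ℤ) + i + 1 - z) = m + i - z + 1 by ring, h6]
    push_cast
    ring
  · obtain rfl : z = m + 1 := by omega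
    push_cast
    ring

lemma sum_hyperSum (K c i m l : ℕ) (hc : c ≤ K + i) :
    ∑ y ∈ Finset.range (c + 1), (-1) ^ y * facZ y * facZ (K + i - y) * rfacZ (y - m) *
        rfacZ (K - y) * rfacZ (c - y) * rfacZ (y - l) =
      (-1) ^ l * facZ m * facZ (K + i + 1) * facZ (K + i - c) * rfacZ (c - m) *
        rfacZ (i - c + m + l) * rfacZ (K - l) * hyperSum K c i m l := by
  induction l generalizing m with
  | zero =>
    rcases lt_or_ge c m with hm | hm
    · rw [rfacZ_of_neg (n := (c : ℤ) - m) (by omega)]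
      rw [Finset.sum_eq_zero]
      · ring
      intro y hy
      have : y < c + 1 := by simpa using hy
      rw [rfacZ_of_neg (n := (y : ℤ) - m) (by omega)]
      ring
    have hh : hyperSum K c i m 0 = (-1) ^ m * facZ i * facZ K * rfacZ (K - m) * rfacZ m *
        rfacZ (i + 1 + K) := by
      rw [← vanderSum_of_gt, hyperSum, vanderSum]
      refine Finset.sum_congr rfl fun z hz => ?_
      have hz : z < m + 1 := by simpa using hz
      have := facZ_mul_rfacZ (n := (c : ℤ) - z) (by omega)
      rw [show (c : ℤ) - (0 : ℕ) - z = c - z by simp,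
        show (K : ℤ) + i + 1 - z = i + 1 + K - z by ring]
      linear_combination (-1) ^ z * facZ (m + i - z) * rfacZ z * rfacZ (m - z) *
        rfacZ (i + 1 + K - z) * this
    rw [hh]
    rcases lt_or_ge K m with hK | hK
    · rw [rfacZ_of_neg (n := (K : ℤ) - m) (by omega)]
      rw [Finset.sum_eq_zero]
      · ring
      intro y hy
      rcases lt_or_ge y m with h | h
      · rw [rfacZ_of_neg (n := (y : ℤ) - m) (by omega)]
        ring
      · rw [rfacZ_of_neg (n := (K : ℤ) - y) (by omega)]
        ring
    obtain ⟨C, rfl⟩ := Nat.exists_eq_add_of_le hm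
    obtain ⟨B, rfl⟩ := Nat.exists_eq_add_of_le hK
    have hv := vanderSum_of_le i C B (by omega)
    rw [add_assoc, Finset.sum_range_add, Finset.sum_eq_zero, zero_add]
    · have hs : ∑ x ∈ Finset.range (C + 1), (-1) ^ (m + x) * facZ (m + x : ℕ) *
          facZ ((m + B : ℕ) + i - (m + x : ℕ)) * rfacZ ((m + x : ℕ) - m) *
          rfacZ ((m + B : ℕ) - (m + x : ℕ)) * rfacZ ((m + C : ℕ) - (m + x : ℕ)) *
          rfacZ ((m + x : ℕ) - (0 : ℕ)) = (-1) ^ m * vanderSum i B C := by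
        rw [vanderSum, sum_range_eq_of_forall_zero (N := C + 1) (M := B + 1), Finset.mul_sum]
        · refine Finset.sum_congr rfl fun x _ => ?_
          have := facZ_mul_rfacZ (n := (m + x : ℕ)) (by omega)
          rw [show ((m + x : ℕ) - (0 : ℕ) : ℤ) = (m + x : ℕ) by simp,
            show ((m + x : ℕ) - m : ℤ) = x by push_cast; ring,
            show ((m + B : ℕ) + i - (m + x : ℕ) : ℤ) = B + i - x by push_cast; ring,
            show ((m + B : ℕ) - (m + x : ℕ) : ℤ) = B - x by push_cast; ring,
            show ((m + C : ℕ) - (m + x : ℕ) : ℤ) = C - x by push_cast; ring, pow_add]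
          linear_combination (-1) ^ m * (-1) ^ x * facZ (B + i - x) * rfacZ x *
            rfacZ (B - x) * rfacZ (C - x) * this
        · rintro z (hz | hz)
          · rw [rfacZ_of_neg (n := (B : ℤ) - z) (by omega)]
            ring
          · rw [rfacZ_of_neg (n := (C : ℤ) - z) (by omega)]
            ring
      rw [hs, hv]
      have h1 := facZ_mul_rfacZ (n := m) (by omega)
      have h2 := facZ_mul_rfacZ (n := (m + B : ℕ)) (by omega)
      have h3 := facZ_mul_rfacZ (n := (m + B : ℕ) + i + 1) (by omega)
      rw [show ((m + B : ℕ) + i - (m + C : ℕ) : ℤ) = B + i - C by push_cast; ring,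
        show ((m + C : ℕ) - m : ℤ) = C by push_cast; ring,
        show ((i : ℤ) - (m + C : ℕ) + m + (0 : ℕ)) = i - C by push_cast; ring,
        show ((m + B : ℕ) - (0 : ℕ) : ℤ) = (m + B : ℕ) by simp,
        show ((m + B : ℕ) - m : ℤ) = B by push_cast; ring,
        show ((i : ℤ) + 1 + (m + B : ℕ)) = (m + B : ℕ) + i + 1 by ring]
      calc _ = (-1) ^ m * (facZ i * facZ (B + i - C) * rfacZ (i - C) * rfacZ B * rfacZ C) *
            (facZ m * rfacZ m) * (facZ (m + B : ℕ) * rfacZ (m + B : ℕ)) *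
            (facZ ((m + B : ℕ) + i + 1) * rfacZ ((m + B : ℕ) + i + 1)) := by
              rw [h1, h2, h3]; ring
        _ = _ := by ring
    · intro y hy
      have : y < m := by simpa using hy
      rw [rfacZ_of_neg (n := (y : ℤ) - m) (by omega)]
      ring
  | succ l ih =>
    have hl : ∑ y ∈ Finset.range (c + 1), (-1) ^ y * facZ y * facZ (K + i - y) *
        rfacZ (y - m) * rfacZ (K - y) * rfacZ (c - y) * rfacZ (y - (l + 1 : ℕ)) =
        ∑ y ∈ Finset.range (c + 1), (-1) ^ y * facZ y * facZ (K + i - y) *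
          rfacZ (y - (m + 1 : ℕ)) * rfacZ (K - y) * rfacZ (c - y) * rfacZ (y - l) +
        ((m : ℚ) - l) * ∑ y ∈ Finset.range (c + 1), (-1) ^ y * facZ y * facZ (K + i - y) *
          rfacZ (y - m) * rfacZ (K - y) * rfacZ (c - y) * rfacZ (y - l) := by
      rw [Finset.mul_sum, ← Finset.sum_add_distrib]
      refine Finset.sum_congr rfl fun y _ => ?_
      have h1 := rfacZ_sub_one ((y : ℤ) - m)
      have h2 := rfacZ_sub_one ((y : ℤ) - l)
      rw [show ((y : ℤ) - (l + 1 : ℕ)) = y - l - 1 by push_cast; ring,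
        show ((y : ℤ) - (m + 1 : ℕ)) = y - m - 1 by push_cast; ring, h1, h2]
      push_cast
      ring
    rw [hl, ih, ih]
    have h1 := rfacZ_sub_one ((c : ℤ) - m)
    have h2 := rfacZ_sub_one ((K : ℤ) - l)
    have h3 := rfacZ_sub_one ((i : ℤ) - c + m + l + 1)
    have h4 := facZ_add_one (n := (m : ℤ)) (by omega)
    rw [add_sub_cancel_right] at h3
    rw [show ((c : ℤ) - (m + 1 : ℕ)) = c - m - 1 by push_cast; ring,
      show ((K : ℤ) - (l + 1 : ℕ)) = K - l - 1 by push_cast; ring,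
      show ((i : ℤ) - c + (m + 1 : ℕ) + l) = i - c + m + l + 1 by push_cast; ring,
      show ((i : ℤ) - c + m + (l + 1 : ℕ)) = i - c + m + l + 1 by push_cast; ring,
      show ((m + 1 : ℕ) : ℤ) = m + 1 by push_cast; ring, h1, h2, h3, h4]
    push_cast
    linear_combination (-1) ^ l * facZ m * facZ (K + i + 1) * facZ (K + i - c) *
      rfacZ (c - m) * rfacZ (i - c + m + l + 1) * rfacZ (K - l) *
      hyperSum_recurrence K c i m l

/-- The sum over the first index of the left-hand double sum, in the shift `n`. -/
def leftSum (m m2 i i' i2 : ℕ) (n l : ℕ) : ℚ :=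
  ∑ z ∈ Finset.range (i2 + 1), (-1) ^ z * facZ (m2 + z) * facZ (m + z) * facZ (i + i' - z) *
    rfacZ z * rfacZ (i - z) * rfacZ (i2 - z) * rfacZ (m - l + z) * rfacZ (m2 + z - n)

/-- The sum over the first index of the right-hand double sum, with second index `y`. -/
def rightSum (m m2 i i' i2 : ℕ) (y l : ℕ) : ℚ :=
  ∑ z ∈ Finset.range (m + 1), (-1) ^ z * facZ (m + i' - z) *
    facZ (m + m2 + (i + i') + 1 - z) * facZ (m + i2 - z) * rfacZ z * rfacZ (m - z) *
    rfacZ (m + (i + i') + 1 - z) * rfacZ (m + i2 - l - z) * rfacZ (m + i - l - y) *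
    rfacZ (m + m2 + (i + i') + 1 - z - y)

lemma leftSum_succ (m m2 i i' i2 n l : ℕ) :
    leftSum m m2 i i' i2 (n + 1) l =
      leftSum m m2 i i' i2 n (l + 1) - ((m : ℚ) - m2 + n - l) * leftSum m m2 i i' i2 n l := by
  simp only [leftSum]
  rw [Finset.mul_sum, ← Finset.sum_sub_distrib]
  refine Finset.sum_congr rfl fun z _ => ?_
  have h1 := rfacZ_sub_one ((m2 : ℤ) + z - n)
  have h2 := rfacZ_sub_one ((m : ℤ) - l + z)
  rw [show ((m2 : ℤ) + z - (n + 1 : ℕ)) = m2 + z - n - 1 by push_cast; ring,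
    show ((m : ℤ) - (l + 1 : ℕ) + z) = m - l + z - 1 by push_cast; ring, h1, h2]
  push_cast
  ring

lemma rightSum_succ (m m2 i i' i2 y l : ℕ) :
    rightSum m m2 i i' i2 (y + 1) l =
      ((m : ℚ) + i - l - y) * ((m2 : ℚ) + (i + i' - i2) + 1 + l - y) * rightSum m m2 i i' i2 y l +
        rightSum m m2 i i' i2 y (l + 1) := by
  simp only [rightSum]
  rw [Finset.mul_sum, ← Finset.sum_add_distrib]
  refine Finset.sum_congr rfl fun z _ => ?_
  have h1 := rfacZ_sub_one ((m : ℤ) + i - l - y)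
  have h2 := rfacZ_sub_one ((m : ℤ) + i2 - l - z)
  have h3 := rfacZ_sub_one ((m : ℤ) + m2 + (i + i') + 1 - z - y)
  rw [show ((m : ℤ) + i - l - (y + 1 : ℕ)) = m + i - l - y - 1 by push_cast; ring,
    show ((m : ℤ) + i - (l + 1 : ℕ) - y) = m + i - l - y - 1 by push_cast; ring,
    show ((m : ℤ) + i2 - (l + 1 : ℕ) - z) = m + i2 - l - z - 1 by push_cast; ring,
    show ((m : ℤ) + m2 + (i + i') + 1 - z - (y + 1 : ℕ)) = m + m2 + (i + i') + 1 - z - y - 1 by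
      push_cast; ring, h1, h2, h3]
  push_cast
  ring

lemma leftSum_zero (m m2 i i' i2 l : ℕ) (h : i2 ≤ i + i') :
    (-1) ^ l * leftSum m m2 i i' i2 0 l = (-1) ^ m * (facZ m * facZ (i + i' - i2) *
      facZ (m + (i + i') + 1) * rfacZ i2) * rfacZ (i' - i2 + l) *
        rightSum m m2 i i' i2 0 l := by
  have hr : rightSum m m2 i i' i2 0 l =
      rfacZ (m + i - l) * hyperSum (m + i) (m + i2) i' m l := by
    rw [rightSum, hyperSum, Finset.mul_sum]
    refine Finset.sum_congr rfl fun z hz => ?_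
    have hz : z < m + 1 := by simpa using hz
    have := facZ_mul_rfacZ (n := (m : ℤ) + m2 + (i + i') + 1 - z) (by omega)
    simp only [Nat.cast_zero, sub_zero, Nat.cast_add]
    rw [show (m : ℤ) + (i + i') + 1 - z = m + i + i' + 1 - z by ring]
    linear_combination (-1) ^ z * facZ (m + i' - z) * facZ (m + i2 - z) * rfacZ z *
      rfacZ (m - z) * rfacZ (m + i + i' + 1 - z) * rfacZ (m + i2 - l - z) *
      rfacZ (m + i - l) * this
  have hB := sum_hyperSum (m + i) (m + i2) i' m l (by omega)
  rw [add_assoc m i2 1, Finset.sum_range_add, Finset.sum_eq_zero, zero_add] at hB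
  · have hs : leftSum m m2 i i' i2 0 l = (-1) ^ m * ∑ x ∈ Finset.range (i2 + 1),
        (-1) ^ (m + x) * facZ (m + x : ℕ) * facZ ((m + i : ℕ) + i' - (m + x : ℕ)) *
          rfacZ ((m + x : ℕ) - m) * rfacZ ((m + i : ℕ) - (m + x : ℕ)) *
          rfacZ ((m + i2 : ℕ) - (m + x : ℕ)) * rfacZ ((m + x : ℕ) - l) := by
      rw [leftSum, Finset.mul_sum]
      refine Finset.sum_congr rfl fun x _ => ?_
      have h1 := facZ_mul_rfacZ (n := (m2 : ℤ) + x) (by omega)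
      have h2 : ((-1 : ℚ) ^ m) ^ 2 = 1 := by rw [← pow_mul, mul_comm, pow_mul]; simp
      rw [show ((m + x : ℕ) - m : ℤ) = x by push_cast; ring,
        show ((m + i : ℕ) + i' - (m + x : ℕ) : ℤ) = i + i' - x by push_cast; ring,
        show ((m + i : ℕ) - (m + x : ℕ) : ℤ) = i - x by push_cast; ring,
        show ((m + i2 : ℕ) - (m + x : ℕ) : ℤ) = i2 - x by push_cast; ring,
        show ((m + x : ℕ) - l : ℤ) = m - l + x by push_cast; ring,
        show ((m + x : ℕ) : ℤ) = m + x by push_cast; ring,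
        show ((m2 : ℤ) + x - (0 : ℕ)) = m2 + x by simp, pow_add]
      calc _ = (facZ (m2 + x) * rfacZ (m2 + x)) * ((-1) ^ x * facZ (m + x) *
            facZ (i + i' - x) * rfacZ x * rfacZ (i - x) * rfacZ (i2 - x) *
            rfacZ (m - l + x)) := by ring
        _ = ((-1 : ℚ) ^ m) ^ 2 * ((-1) ^ x * facZ (m + x) *
            facZ (i + i' - x) * rfacZ x * rfacZ (i - x) * rfacZ (i2 - x) *
            rfacZ (m - l + x)) := by rw [h1, h2]
        _ = _ := by ring
    have h2 : ((-1 : ℚ) ^ l) ^ 2 = 1 := by rw [← pow_mul, mul_comm, pow_mul]; simp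
    rw [hs, hB, hr, show ((m + i : ℕ) + i' + 1 : ℤ) = m + (i + i') + 1 by push_cast; ring,
      show ((m + i : ℕ) + i' - (m + i2 : ℕ) : ℤ) = i + i' - i2 by push_cast; ring,
      show ((m + i2 : ℕ) - m : ℤ) = i2 by push_cast; ring,
      show ((i' : ℤ) - (m + i2 : ℕ) + m + l) = i' - i2 + l by push_cast; ring,
      show ((m + i : ℕ) - l : ℤ) = m + i - l by push_cast; ring]
    linear_combination (-1) ^ m * facZ m * facZ (m + (i + i') + 1) * facZ (i + i' - i2) *
      rfacZ i2 * rfacZ (i' - i2 + l) * rfacZ (m + i - l) *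
      hyperSum (m + i) (m + i2) i' m l * h2
  · intro y hy
    have : y < m := by simpa using hy
    rw [rfacZ_of_neg (n := (y : ℤ) - m) (by omega)]
    ring

/-- The functions obtained from `T` by iterating the two-term recurrence shared with
`leftSum`, up to normalisation. -/
def ladder (δ w : ℚ) (T : ℕ → ℚ) : ℕ → ℕ → ℚ
  | 0, l => T l
  | n + 1, l => -(δ + n - l) * (w + n + l + 1) * ladder δ w T n l - ladder δ w T n (l + 1)

lemma leftSum_eq_ladder (m m2 i i' i2 n l : ℕ) (h : i2 ≤ i + i') :
    (-1) ^ l * leftSum m m2 i i' i2 n l = (-1) ^ m * (facZ m * facZ (i + i' - i2) *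
      facZ (m + (i + i') + 1) * rfacZ i2) * rfacZ (i' - i2 + n + l) *
        ladder (m - m2) (i' - i2) (rightSum m m2 i i' i2 0) n l := by
  induction n generalizing l with
  | zero =>
    rw [leftSum_zero _ _ _ _ _ _ h, ladder]
    simp
  | succ n ih =>
    have h1 := ih l
    have h2 := ih (l + 1)
    have h3 := rfacZ_sub_one ((i' : ℤ) - i2 + n + l + 1)
    rw [add_sub_cancel_right] at h3
    rw [show ((i' : ℤ) - i2 + n + (l + 1 : ℕ)) = i' - i2 + n + l + 1 by push_cast; ring] at h2
    rw [leftSum_succ, ladder,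
      show ((i' : ℤ) - i2 + (n + 1 : ℕ) + l) = i' - i2 + n + l + 1 by push_cast; ring]
    rw [h3] at h1
    push_cast at h1
    linear_combination -((m : ℚ) - m2 + n - l) * h1 - h2

/-- The coefficients expressing the solutions of the recurrence of `rightSum` in terms of
`ladder`. -/
def connCoeff (g s y n : ℕ) : ℚ :=
  (-1) ^ n * facZ y * rfacZ n * rfacZ (y - n) * facZ (g - n) * rfacZ (g - y) * facZ s *
    rfacZ (s - y + n)

lemma connCoeff_succ_zero (g s y : ℕ) :
    connCoeff g s (y + 1) 0 = ((g : ℚ) - y) * (s - y) * connCoeff g s y 0 := by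
  have h1 := rfacZ_sub_one ((g : ℤ) - y)
  have h2 := rfacZ_sub_one ((s : ℤ) - y)
  have h3 := facZ_mul_rfacZ (n := (y : ℤ)) (by omega)
  have h4 := facZ_mul_rfacZ (n := (y : ℤ) + 1) (by omega)
  simp only [connCoeff]
  rw [show ((g : ℤ) - (y + 1 : ℕ)) = g - y - 1 by push_cast; ring,
    show ((s : ℤ) - (y + 1 : ℕ) + (0 : ℕ)) = s - y - 1 by push_cast; ring,
    show ((s : ℤ) - y + (0 : ℕ)) = s - y by simp,
    show (((y + 1 : ℕ) : ℤ) - (0 : ℕ)) = y + 1 by simp,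
    show ((y : ℤ) - (0 : ℕ)) = y by simp, show (((y + 1 : ℕ) : ℤ)) = y + 1 by simp, h1, h2]
  push_cast
  linear_combination rfacZ 0 * facZ (g - 0) * ((g : ℚ) - y) * rfacZ (g - y) * facZ s *
    ((s : ℚ) - y) * rfacZ (s - y) * (h4 - h3)

lemma connCoeff_succ_succ (g s y n : ℕ) (hn : n < g) :
    connCoeff g s (y + 1) (n + 1) =
      ((g : ℚ) - y - (n + 1)) * (s + (n + 1) - y) * connCoeff g s y (n + 1) -
        connCoeff g s y n := by
  have h1 := rfacZ_sub_one ((g : ℤ) - y)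
  have h2 := rfacZ_sub_one ((s : ℤ) - y + n + 1)
  have h3 := facZ_add_one (n := (y : ℤ)) (by omega)
  have h4 := rfacZ_sub_one ((n : ℤ) + 1)
  have h5 := rfacZ_sub_one ((y : ℤ) - n)
  have h6 := facZ_add_one (n := (g : ℤ) - n - 1) (by omega)
  rw [add_sub_cancel_right] at h2 h4
  rw [sub_add_cancel] at h6
  simp only [connCoeff]
  rw [show ((g : ℤ) - (y + 1 : ℕ)) = g - y - 1 by push_cast; ring,
    show ((s : ℤ) - (y + 1 : ℕ) + (n + 1 : ℕ)) = s - y + n by push_cast; ring,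
    show ((s : ℤ) - y + (n + 1 : ℕ)) = s - y + n + 1 by push_cast; ring,
    show (((y + 1 : ℕ) : ℤ) - (n + 1 : ℕ)) = y - n by push_cast; ring,
    show ((y : ℤ) - (n + 1 : ℕ)) = y - n - 1 by push_cast; ring,
    show ((g : ℤ) - (n + 1 : ℕ)) = g - n - 1 by push_cast; ring,
    show (((y + 1 : ℕ) : ℤ)) = y + 1 by simp, show (((n + 1 : ℕ) : ℤ)) = n + 1 by simp,
    h1, h2, h3, h4, h5, h6]
  push_cast
  ring

lemma eq_sum_connCoeff_ladder (p q : ℚ) (g s : ℕ) (hs : (s : ℚ) = p + q - g) (T : ℕ → ℕ → ℚ)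
    (hT : ∀ y l, T (y + 1) l = (p - l - y) * (q + l - y) * T y l + T y (l + 1))
    (y l : ℕ) (hy : y ≤ g) :
    T y l = ∑ n ∈ Finset.range (y + 1),
      connCoeff g s y n * ladder (p - g) (q - g - 1) (T 0) n l := by
  induction y generalizing l with
  | zero =>
    have h1 := facZ_mul_rfacZ (n := (g : ℤ)) (by omega)
    have h2 := facZ_mul_rfacZ (n := (s : ℤ)) (by omega)
    simp only [zero_add, Finset.sum_range_one, connCoeff, ladder, Nat.cast_zero, sub_zero,
      add_zero, facZ_zero, rfacZ_zero]
    linear_combination -T 0 l * facZ g * rfacZ g * h2 - T 0 l * h1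
  | succ y ih =>
    have hl : ∀ n, ladder (p - g) (q - g - 1) (T 0) n (l + 1) =
        -(p - g + n - l) * (q - g + n + l) * ladder (p - g) (q - g - 1) (T 0) n l -
          ladder (p - g) (q - g - 1) (T 0) (n + 1) l := by
      intro n
      rw [ladder]
      ring
    rw [hT, ih l (by omega), ih (l + 1) (by omega), Finset.sum_range_succ' _ (y + 1),
      connCoeff_succ_zero]
    have hc : ∑ n ∈ Finset.range (y + 1), connCoeff g s (y + 1) (n + 1) *
          ladder (p - g) (q - g - 1) (T 0) (n + 1) l =
        ∑ n ∈ Finset.range (y + 1), (((g : ℚ) - y - (n + 1 : ℕ)) * (s + (n + 1 : ℕ) - y) *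
            connCoeff g s y (n + 1) * ladder (p - g) (q - g - 1) (T 0) (n + 1) l) -
          ∑ n ∈ Finset.range (y + 1), connCoeff g s y n *
            ladder (p - g) (q - g - 1) (T 0) (n + 1) l := by
      rw [← Finset.sum_sub_distrib]
      refine Finset.sum_congr rfl fun n hn => ?_
      have hn : n < y + 1 := by simpa using hn
      rw [connCoeff_succ_succ _ _ _ _ (by omega)]
      push_cast
      ring
    have hz : connCoeff g s y (y + 1) = 0 := by
      rw [connCoeff, rfacZ_of_neg (n := (y : ℤ) - (y + 1 : ℕ)) (by omega)]
      ring
    have hd := Finset.sum_range_succ' (fun n : ℕ => ((g : ℚ) - y - n) * (s + n - y) *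
      connCoeff g s y n * ladder (p - g) (q - g - 1) (T 0) n l) (y + 1)
    rw [Finset.sum_range_succ _ (y + 1), hz] at hd
    have he : (p - l - y) * (q + l - y) * (∑ n ∈ Finset.range (y + 1), connCoeff g s y n *
          ladder (p - g) (q - g - 1) (T 0) n l) + ∑ n ∈ Finset.range (y + 1),
          connCoeff g s y n * ladder (p - g) (q - g - 1) (T 0) n (l + 1) =
        ∑ n ∈ Finset.range (y + 1), ((g : ℚ) - y - n) * (s + n - y) *
          connCoeff g s y n * ladder (p - g) (q - g - 1) (T 0) n l -
        ∑ n ∈ Finset.range (y + 1), connCoeff g s y n *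
            ladder (p - g) (q - g - 1) (T 0) (n + 1) l := by
      rw [Finset.mul_sum, ← Finset.sum_add_distrib, ← Finset.sum_sub_distrib]
      refine Finset.sum_congr rfl fun n _ => ?_
      rw [hl, hs]
      ring
    rw [he, hc]
    push_cast at hd ⊢
    linear_combination hd

/-- A terminating Saalschützian `₃F₂` sum. -/
def saalSum (α₁ α₂ α₃ t : ℕ) : ℚ :=
  ∑ y ∈ Finset.range (t + 1), (-1) ^ y * facZ (α₂ + y) * facZ (α₁ + α₂ + α₃ + 1 + y) *
    rfacZ y * rfacZ (t - y) * rfacZ (α₂ + α₃ + 1 + y) * rfacZ (α₁ + α₂ + 1 - t + y)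

lemma saalSum_succ (α₁ α₂ α₃ t : ℕ) :
    ((t : ℚ) + 1) * (α₂ + α₃ + 1 + t + 1) * saalSum α₁ α₂ α₃ (t + 1) =
      (α₃ + t + 1) * (α₁ - t) * saalSum α₁ α₂ α₃ t := by
  have ext : saalSum α₁ α₂ α₃ t = ∑ y ∈ Finset.range (t + 2),
      (-1) ^ y * facZ (α₂ + y) * facZ (α₁ + α₂ + α₃ + 1 + y) *
        rfacZ y * rfacZ (t - y) * rfacZ (α₂ + α₃ + 1 + y) * rfacZ (α₁ + α₂ + 1 - t + y) := by
    rw [Finset.sum_range_succ, rfacZ_of_neg (n := (t : ℤ) - (t + 1 : ℕ)) (by omega)]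
    simp [saalSum]
  let S : ℕ → ℚ := fun y => -(-1) ^ y * facZ (α₂ + y) * facZ (α₁ + α₂ + α₃ + 1 + y) *
    rfacZ (y - 1) * rfacZ (t + 1 - y) * rfacZ (α₂ + α₃ + 1 + y - 1) *
    rfacZ (α₁ + α₂ + 1 - t + y - 1)
  rw [← sub_eq_zero, ext, saalSum, Finset.mul_sum, Finset.mul_sum, ← Finset.sum_sub_distrib]
  rw [Finset.sum_congr rfl (g := fun y => S (y + 1) - S y), Finset.sum_range_sub]
  · simp only [S]
    rw [rfacZ_of_neg (n := (t : ℤ) + 1 - (t + 2 : ℕ)) (by push_cast; omega),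
      rfacZ_of_neg (n := ((0 : ℕ) : ℤ) - 1) (by omega)]
    ring
  intro y _
  have h1 := rfacZ_sub_one (y : ℤ)
  have h2 := rfacZ_sub_one ((t : ℤ) + 1 - y)
  have h3 := rfacZ_sub_one ((α₂ : ℤ) + α₃ + 1 + y)
  have h4 := rfacZ_sub_one ((α₁ : ℤ) + α₂ + 1 - t + y)
  have h5 := facZ_add_one (n := (α₂ : ℤ) + y) (by omega)
  have h6 := facZ_add_one (n := (α₁ : ℤ) + α₂ + α₃ + 1 + y) (by omega)
  simp only [S]
  rw [show (((t + 1 : ℕ) : ℤ) - y) = t + 1 - y by simp,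
    show ((α₁ : ℤ) + α₂ + 1 - (t + 1 : ℕ) + y) = α₁ + α₂ + 1 - t + y - 1 by push_cast; ring,
    show ((t : ℤ) - y) = t + 1 - y - 1 by ring,
    show ((α₂ : ℤ) + (y + 1 : ℕ)) = α₂ + y + 1 by push_cast; ring,
    show ((α₁ : ℤ) + α₂ + α₃ + 1 + (y + 1 : ℕ)) = α₁ + α₂ + α₃ + 1 + y + 1 by push_cast; ring,
    show (((y + 1 : ℕ) : ℤ) - 1) = y by push_cast; ring,
    show ((t : ℤ) + 1 - (y + 1 : ℕ)) = t + 1 - y - 1 by push_cast; ring,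
    show ((α₂ : ℤ) + α₃ + 1 + (y + 1 : ℕ) - 1) = α₂ + α₃ + 1 + y by push_cast; ring,
    show ((α₁ : ℤ) + α₂ + 1 - t + (y + 1 : ℕ) - 1) = α₁ + α₂ + 1 - t + y by push_cast; ring,
    h1, h2, h3, h4, h5, h6]
  push_cast
  ring

lemma saalSum_eq (α₁ α₂ α₃ t : ℕ) :
    saalSum α₁ α₂ α₃ t = facZ α₂ * facZ (α₁ + α₂ + α₃ + 1) * rfacZ (α₁ + α₂ + 1) * facZ α₁ *
      rfacZ (α₁ - t) * facZ (α₃ + t) * rfacZ α₃ * rfacZ t * rfacZ (α₂ + α₃ + 1 + t) := by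
  induction t with
  | zero =>
    have h1 := facZ_mul_rfacZ (n := (α₁ : ℤ)) (by omega)
    have h2 := facZ_mul_rfacZ (n := (α₃ : ℤ)) (by omega)
    simp only [saalSum, zero_add, Finset.sum_range_one, Nat.cast_zero, sub_zero, add_zero,
      rfacZ_zero, pow_zero]
    linear_combination -facZ α₂ * facZ (α₁ + α₂ + α₃ + 1) * rfacZ (α₂ + α₃ + 1) *
      rfacZ (α₁ + α₂ + 1) * (facZ α₃ * rfacZ α₃ * h1 + h2)
  | succ t ih =>
    have h := saalSum_succ α₁ α₂ α₃ t
    rw [ih] at h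
    have h1 := rfacZ_sub_one ((α₁ : ℤ) - t)
    have h2 := facZ_add_one (n := (α₃ : ℤ) + t) (by omega)
    have h3 := rfacZ_sub_one ((t : ℤ) + 1)
    have h4 := rfacZ_sub_one ((α₂ : ℤ) + α₃ + 1 + t + 1)
    rw [add_sub_cancel_right] at h3 h4
    rw [show ((α₁ : ℤ) - (t + 1 : ℕ)) = α₁ - t - 1 by push_cast; ring,
      show ((α₃ : ℤ) + (t + 1 : ℕ)) = α₃ + t + 1 by push_cast; ring,
      show ((α₂ : ℤ) + α₃ + 1 + (t + 1 : ℕ)) = α₂ + α₃ + 1 + t + 1 by push_cast; ring,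
      show (((t + 1 : ℕ) : ℤ)) = t + 1 by simp, h1, h2]
    rw [h3, h4] at h
    have hne : ((t : ℚ) + 1) * (α₂ + α₃ + 1 + t + 1) ≠ 0 := by positivity
    apply mul_left_cancel₀ hne
    rw [h]
    push_cast
    ring

lemma neg_one_pow_mul_self (n : ℕ) : (-1 : ℚ) ^ n * (-1) ^ n = 1 := by
  rw [← mul_pow]
  simp

lemma sum_weight_connCoeff (α₁ α₂ α₃ ε n t : ℕ) :
    ∑ y ∈ Finset.range (n + t + 1), (-1) ^ y * (facZ (α₂ + (n + t) - y) *
        facZ (α₁ + α₂ + α₃ + (n + t) + 1 - y) * facZ (n + t + ε - y) * rfacZ y *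
        rfacZ (n + t - y) * rfacZ (n + t + α₂ + α₃ + 1 - y)) *
        connCoeff (n + t + ε) (α₁ + α₂ + 1) y n =
      (-1) ^ t * facZ (α₁ + α₂ + 1) * rfacZ n * facZ (ε + t) * saalSum α₁ α₂ α₃ t := by
  rw [add_assoc n t 1, Finset.sum_range_add, Finset.sum_eq_zero, zero_add]
  · rw [← Finset.sum_range_reflect, saalSum, Finset.mul_sum]
    refine Finset.sum_congr rfl fun x hx => ?_
    have hx : x < t + 1 := by simpa using hx
    obtain ⟨u, rfl⟩ := Nat.exists_eq_add_of_le (Nat.lt_succ_iff.mp hx)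
    rw [show x + u + 1 - 1 - x = u by omega, connCoeff]
    have h1 := facZ_mul_rfacZ (n := ((n + u : ℕ) : ℤ)) (by omega)
    have h2 := facZ_mul_rfacZ (n := (ε : ℤ) + x) (by omega)
    have h3 := neg_one_pow_mul_self n
    have h4 := neg_one_pow_mul_self x
    rw [show ((α₂ : ℤ) + (n + (x + u : ℕ)) - (n + u : ℕ)) = α₂ + x by push_cast; ring,
      show ((α₁ : ℤ) + α₂ + α₃ + (n + (x + u : ℕ)) + 1 - (n + u : ℕ)) =
        α₁ + α₂ + α₃ + 1 + x by push_cast; ring,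
      show ((n : ℤ) + (x + u : ℕ) + ε - (n + u : ℕ)) = ε + x by push_cast; ring,
      show ((n : ℤ) + (x + u : ℕ) - (n + u : ℕ)) = x by push_cast; ring,
      show ((n : ℤ) + (x + u : ℕ) + α₂ + α₃ + 1 - (n + u : ℕ)) = α₂ + α₃ + 1 + x by
        push_cast; ring,
      show (((n + u : ℕ) : ℤ) - n) = u by push_cast; ring,
      show (((n + (x + u) + ε : ℕ) : ℤ) - n) = ε + (x + u : ℕ) by push_cast; ring,
      show (((n + (x + u) + ε : ℕ) : ℤ) - (n + u : ℕ)) = ε + x by push_cast; ring,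
      show (((α₁ + α₂ + 1 : ℕ) : ℤ) - (n + u : ℕ) + n) = α₁ + α₂ + 1 - (x + u : ℕ) + x by
        push_cast; ring,
      show (((x + u : ℕ) : ℤ) - x) = u by push_cast; ring,
      show ((α₁ + α₂ + 1 : ℕ) : ℤ) = α₁ + α₂ + 1 by push_cast; ring, pow_add, pow_add]
    set P := facZ (α₂ + x) * facZ (α₁ + α₂ + α₃ + 1 + x) * rfacZ x *
      rfacZ (α₂ + α₃ + 1 + x) * rfacZ n * rfacZ u * facZ (ε + (x + u : ℕ)) *
      facZ (α₁ + α₂ + 1) * rfacZ (α₁ + α₂ + 1 - (x + u : ℕ) + x) * (-1) ^ u with hP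
    calc _ = ((-1) ^ n * (-1) ^ n) * (facZ (n + u : ℕ) * rfacZ (n + u : ℕ)) *
          (facZ (ε + x) * rfacZ (ε + x)) * P := by rw [hP]; ring
      _ = ((-1) ^ x * (-1) ^ x) * P := by rw [h1, h2, h3, h4]; ring
      _ = _ := by rw [hP]; ring
  · intro y hy
    have : y < n := by simpa using hy
    rw [connCoeff, rfacZ_of_neg (n := (y : ℤ) - n) (by omega)]
    ring

lemma sum_weight_eq (α₁ α₂ α₃ ε D : ℕ) (T L : ℕ → ℚ)
    (hT : ∀ y ≤ D, T y = ∑ n ∈ Finset.range (y + 1),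
      connCoeff (D + ε) (α₁ + α₂ + 1) y n * L n) :
    ∑ y ∈ Finset.range (D + 1), (-1) ^ y * (facZ (α₂ + D - y) *
        facZ (α₁ + α₂ + α₃ + D + 1 - y) * facZ (D + ε - y) * rfacZ y *
        rfacZ (D - y) * rfacZ (D + α₂ + α₃ + 1 - y)) * T y =
      (facZ α₁ * facZ α₂ * facZ (α₁ + α₂ + α₃ + 1) * rfacZ α₃) *
        ∑ t ∈ Finset.range (D + 1), (-1) ^ t * (facZ (α₃ + t) * facZ (ε + t) * rfacZ t *
          rfacZ (α₁ - t) * rfacZ (D - t) * rfacZ (α₂ + α₃ + 1 + t)) * L (D - t) := by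
  have hext : ∀ y ∈ Finset.range (D + 1), T y = ∑ n ∈ Finset.range (D + 1),
      connCoeff (D + ε) (α₁ + α₂ + 1) y n * L n := by
    intro y hy
    have hy : y < D + 1 := by simpa using hy
    rw [hT y (by omega)]
    refine sum_range_eq_of_forall_zero fun n hn => ?_
    rw [connCoeff, rfacZ_of_neg (n := (y : ℤ) - n) (by omega)]
    ring
  refine (Finset.sum_congr rfl fun y hy => congrArg (HMul.hMul _) (hext y hy)).trans ?_
  simp only [Finset.mul_sum]
  rw [Finset.sum_comm, ← Finset.sum_range_reflect]
  refine Finset.sum_congr rfl fun t ht => ?_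
  have ht : t < D + 1 := by simpa using ht
  obtain ⟨n, rfl⟩ := Nat.exists_eq_add_of_le' (Nat.lt_succ_iff.mp ht)
  have h1 := sum_weight_connCoeff α₁ α₂ α₃ ε n t
  rw [saalSum_eq] at h1
  have h2 := facZ_mul_rfacZ (n := (α₁ : ℤ) + α₂ + 1) (by omega)
  rw [show n + t + 1 - 1 - t = n by omega, show n + t - t = n by omega,
    show (((n + t : ℕ) : ℤ) - t) = n by push_cast; ring]
  push_cast
  simp only [← mul_assoc] at h1 ⊢
  rw [← Finset.sum_mul, h1]
  linear_combination (-1) ^ t * rfacZ n * facZ (ε + t) * facZ α₂ *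
    facZ (α₁ + α₂ + α₃ + 1) * facZ α₁ * rfacZ (α₁ - t) * facZ (α₃ + t) * rfacZ α₃ * rfacZ t *
    rfacZ (α₂ + α₃ + 1 + t) * L n * h2

theorem double_sum_eq (m m2 i i' i2 i2' α₁ α₂ α₃ D ε l : ℕ) (hH : i + i' = i2 + i2')
    (ha : α₁ + α₂ = m + i2') (hg : D + ε = m2 + i) (hl : α₁ + i2 ≤ i' + D + l) :
    (facZ α₁ * facZ α₂ * facZ (α₁ + α₂ + α₃ + 1) * rfacZ α₃) *
        ∑ y ∈ Finset.range (D + 1), (-1) ^ y * (facZ (α₃ + y) * facZ (ε + y) * rfacZ y *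
          rfacZ (α₁ - y) * rfacZ (D - y) * rfacZ (α₂ + α₃ + 1 + y)) *
          facZ (i' - i2 + D - y + l) * leftSum m m2 i i' i2 (D - y) l =
      (-1) ^ (m + l) * (facZ m * facZ i2' * facZ (m + i2 + i2' + 1) * rfacZ i2) *
        ∑ y ∈ Finset.range (D + 1), (-1) ^ y * (facZ (α₂ + D - y) *
          facZ (α₁ + α₂ + α₃ + D + 1 - y) * facZ (D + ε - y) * rfacZ y *
          rfacZ (D - y) * rfacZ (D + α₂ + α₃ + 1 - y)) * rightSum m m2 i i' i2 y l := by
  have hHq : (i : ℚ) + i' = i2 + i2' := by exact_mod_cast hH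
  have hHz : (i : ℤ) + i' = i2 + i2' := by exact_mod_cast hH
  have hgq : (D : ℚ) + ε = m2 + i := by exact_mod_cast hg
  have haq : (α₁ : ℚ) + α₂ = m + i2' := by exact_mod_cast ha
  rw [sum_weight_eq α₁ α₂ α₃ ε D (fun y => rightSum m m2 i i' i2 y l)
    (fun n => ladder (m - m2) (i' - i2) (rightSum m m2 i i' i2 0) n l)]
  · rw [mul_left_comm]
    congr 1
    rw [Finset.mul_sum]
    refine Finset.sum_congr rfl fun y hy => ?_
    have hy : y < D + 1 := by simpa using hy
    obtain ⟨n, rfl⟩ := Nat.exists_eq_add_of_le' (Nat.lt_succ_iff.mp hy)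
    rw [show n + y - y = n by omega]
    rcases lt_or_ge α₁ y with hα | hα
    · rw [rfacZ_of_neg (n := (α₁ : ℤ) - y) (by omega)]
      ring
    have h1 := leftSum_eq_ladder m m2 i i' i2 n l (by omega)
    have h2 := facZ_mul_rfacZ (n := (i' : ℤ) - i2 + n + l) (by omega)
    have h3 := neg_one_pow_mul_self l
    rw [show ((i : ℤ) + i' - i2) = i2' by linarith,
      show ((m : ℤ) + (i + i') + 1) = m + i2 + i2' + 1 by linarith] at h1
    rw [show ((i' : ℤ) - i2 + (n + y : ℕ) - y + l) = i' - i2 + n + l by push_cast; ring]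
    have h4 : facZ (i' - i2 + n + l) * leftSum m m2 i i' i2 n l =
        (-1) ^ (m + l) * (facZ m * facZ i2' * facZ (m + i2 + i2' + 1) * rfacZ i2) *
          ladder (m - m2) (i' - i2) (rightSum m m2 i i' i2 0) n l := by
      rw [pow_add]
      linear_combination facZ (i' - i2 + n + l) * (-1) ^ l * h1 +
        (-1) ^ m * (-1) ^ l * (facZ m * facZ i2' * facZ (m + i2 + i2' + 1) * rfacZ i2) *
          ladder (m - m2) (i' - i2) (rightSum m m2 i i' i2 0) n l * h2 -
        facZ (i' - i2 + n + l) * leftSum m m2 i i' i2 n l * h3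
    rw [mul_assoc, h4]
    ring
  · intro y hy
    have h := eq_sum_connCoeff_ladder (m + i) (m2 + (i + i' - i2) + 1) (D + ε) (α₁ + α₂ + 1)
      (by push_cast; linarith) (rightSum m m2 i i' i2)
      (fun y l => rightSum_succ _ _ _ _ _ y l) y l (by omega)
    rw [h, show ((m : ℚ) + i - (D + ε : ℕ)) = m - m2 by push_cast; linarith,
      show ((m2 : ℚ) + (i + i' - i2) + 1 - (D + ε : ℕ) - 1) = i' - i2 by push_cast; linarith]

lemma fct_eq_facZ {x : ℚ} {n : ℤ} (h : x = n) : fct x = facZ n := by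
  subst h
  simp [fct, facZ]

lemma neg1pw_natCast {x : ℚ} {n : ℕ} (h : x = n) : neg1pw x = (-1) ^ n := by
  subst h
  simp [neg1pw]

lemma finsum_eq_sum_range {f : ℕ → ℚ} {N : ℕ} (h : ∀ z, N ≤ z → f z = 0) :
    ∑ᶠ z, f z = ∑ z ∈ Finset.range N, f z := by
  refine finsum_eq_sum_of_support_subset f fun z hz => ?_
  by_contra hN
  exact hz (h z (by simpa using hN))

/-- A triple `finsum` over `ℕ` supported in a box, with the middle index taken outermost. -/
lemma finsum_eq_sum_range_box {f : ℕ → ℕ → ℕ → ℚ} {L M N : ℕ}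
    (h1 : ∀ x y z, L ≤ x → f x y z = 0) (h2 : ∀ x y z, M ≤ y → f x y z = 0)
    (h3 : ∀ x y z, N ≤ z → f x y z = 0) :
    ∑ᶠ x, ∑ᶠ y, ∑ᶠ z, f x y z = ∑ y ∈ Finset.range M, ∑ z ∈ Finset.range N,
      ∑ x ∈ Finset.range L, f x y z := by
  have hz : ∀ x y, ∑ᶠ z, f x y z = ∑ z ∈ Finset.range N, f x y z := fun x y =>
    finsum_eq_sum_range (h3 x y)
  have hy : ∀ x, ∑ᶠ y, ∑ᶠ z, f x y z =
      ∑ y ∈ Finset.range M, ∑ z ∈ Finset.range N, f x y z := fun x => by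
    simp only [hz]
    exact finsum_eq_sum_range fun y hy => Finset.sum_eq_zero fun z _ => h2 x y z hy
  simp only [hy]
  rw [finsum_eq_sum_range fun x hx => Finset.sum_eq_zero fun y _ =>
    Finset.sum_eq_zero fun z _ => h1 x y z hx, Finset.sum_comm]
  exact Finset.sum_congr rfl fun y _ => Finset.sum_comm

/-- The factors depending only on the middle summation index, common to both triple sums. -/
def middleWeight (b c d f k : ℚ) (z : ℕ) : ℚ :=
  fct (2 * d - z) * fct (c - d + f + z) /
    ((Nat.factorial z : ℚ) * fct (d - b + k - z) * fct (c + d - f - z) *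
      fct (b + d + k + 1 - z))

lemma sumSA_eq {a b c d e f g h k : ℚ} {m m2 i i' i2 α₁ α₂ α₃ D ε P : ℕ}
    (hm : a + c - h = m) (hi2 : -a + c + h = i2) (hi' : h + k - g = i') (hi : h - k + g = i)
    (hm2 : -h + k + g = m2) (hα₁ : a + b - e = α₁) (hα₂ : a - b + e = α₂)
    (hα₃ : -a + b + e = α₃) (hε : e - f + g = ε) (hD : -e + f + g = D) (hP : c + d - f = P) :
    sumSA a b c d e f g h k = ∑ x ∈ Finset.range (P + 1), (-1) ^ x * middleWeight b c d f k x *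
      ∑ y ∈ Finset.range (D + 1), (-1) ^ y * (facZ (α₃ + y) * facZ (ε + y) * rfacZ y *
        rfacZ (α₁ - y) * rfacZ (D - y) * rfacZ (α₂ + α₃ + 1 + y)) *
        facZ (i' - i2 + D - y + (P - x : ℕ)) * leftSum m m2 i i' i2 (D - y) (P - x) := by
  rw [sumSA, finsum_eq_sum_range_box (L := i2 + 1) (M := P + 1) (N := D + 1)]
  · refine Finset.sum_congr rfl fun x hx => ?_
    have hx : x < P + 1 := by simpa using hx
    rw [Finset.mul_sum]
    refine Finset.sum_congr rfl fun y hy => ?_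
    have hy : y < D + 1 := by simpa using hy
    rw [leftSum, Finset.mul_sum, Finset.mul_sum]
    refine Finset.sum_congr rfl fun z _ => ?_
    have cx : ((P - x : ℕ) : ℚ) = P - x := Nat.cast_sub (by omega)
    have cy : ((D - y : ℕ) : ℚ) = D - y := Nat.cast_sub (by omega)
    rw [← facZ_natCast z, ← facZ_natCast y, middleWeight,
      fct_eq_facZ (x := g - h + k + z) (n := m2 + z) (by push_cast; linarith),
      fct_eq_facZ (x := a + c - h + z) (n := m + z) (by push_cast; linarith),
      fct_eq_facZ (x := 2 * h - z) (n := i + i' - z) (by push_cast; linarith),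
      fct_eq_facZ (x := g + h - k - z) (n := i - z) (by push_cast; linarith),
      fct_eq_facZ (x := c - a + h - z) (n := i2 - z) (by push_cast; linarith),
      fct_eq_facZ (x := b + e - a + y) (n := α₃ + y) (by push_cast; linarith),
      fct_eq_facZ (x := e - f + g + y) (n := ε + y) (by push_cast; linarith),
      fct_eq_facZ (x := a + b - e - y) (n := α₁ - y) (by push_cast; linarith),
      fct_eq_facZ (x := f + g - e - y) (n := D - y) (by push_cast; linarith),
      fct_eq_facZ (x := 2 * e + 1 + y) (n := α₂ + α₃ + 1 + y) (by push_cast; linarith),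
      fct_eq_facZ (x := a + d - e + k - x - y) (n := i' - i2 + D - y + (P - x : ℕ))
        (by push_cast [cx]; linarith),
      fct_eq_facZ (x := a - d + f - h + z + x) (n := m - (P - x : ℕ) + z)
        (by push_cast [cx]; linarith),
      fct_eq_facZ (x := e - f - h + k + z + y) (n := m2 + z - (D - y : ℕ))
        (by push_cast [cy]; linarith)]
    simp only [rfacZ, div_eq_mul_inv, mul_inv, pow_add]
    ring
  · intro z x y hz
    rw [fct_eq_facZ (x := c - a + h - z) (n := i2 - z) (by push_cast; linarith),
      facZ_of_neg (n := i2 - z) (by omega)]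
    simp
  · intro z x y hx
    rw [fct_eq_facZ (x := c + d - f - x) (n := P - x) (by push_cast; linarith),
      facZ_of_neg (n := P - x) (by omega)]
    simp
  · intro z x y hy
    rw [fct_eq_facZ (x := f + g - e - y) (n := D - y) (by push_cast; linarith),
      facZ_of_neg (n := D - y) (by omega)]
    simp

lemma sumSC_eq {a b c d e f g h k : ℚ} {m m2 i i' i2 α₁ α₂ α₃ D ε P : ℕ}
    (hm : a + c - h = m) (hi2 : -a + c + h = i2) (hi' : h + k - g = i') (hi : h - k + g = i)
    (hm2 : -h + k + g = m2) (hα₁ : a + b - e = α₁) (hα₂ : a - b + e = α₂)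
    (hα₃ : -a + b + e = α₃) (hε : e - f + g = ε) (hD : -e + f + g = D) (hP : c + d - f = P) :
    sumSC a b c d e f g h k = ∑ x ∈ Finset.range (P + 1), middleWeight b c d f k x *
      ∑ y ∈ Finset.range (D + 1), (-1) ^ y * (facZ (α₂ + D - y) *
        facZ (α₁ + α₂ + α₃ + D + 1 - y) * facZ (D + ε - y) * rfacZ y *
        rfacZ (D - y) * rfacZ (D + α₂ + α₃ + 1 - y)) *
        rightSum m m2 i i' i2 y (P - x) := by
  rw [sumSC, finsum_eq_sum_range_box (L := m + 1) (M := P + 1) (N := D + 1)]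
  · refine Finset.sum_congr rfl fun x hx => ?_
    have hx : x < P + 1 := by simpa using hx
    rw [Finset.mul_sum]
    refine Finset.sum_congr rfl fun y _ => ?_
    rw [rightSum, Finset.mul_sum, Finset.mul_sum]
    refine Finset.sum_congr rfl fun z _ => ?_
    have cx : ((P - x : ℕ) : ℚ) = P - x := Nat.cast_sub (by omega)
    rw [← facZ_natCast z, ← facZ_natCast y, middleWeight,
      fct_eq_facZ (x := a + c - g + k - z) (n := m + i' - z) (by push_cast; linarith),
      fct_eq_facZ (x := a + c + g + k + 1 - z) (n := m + m2 + (i + i') + 1 - z)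
        (by push_cast; linarith),
      fct_eq_facZ (x := 2 * c - z) (n := m + i2 - z) (by push_cast; linarith),
      fct_eq_facZ (x := a + c - h - z) (n := m - z) (by push_cast; linarith),
      fct_eq_facZ (x := a + c + h + 1 - z) (n := m + (i + i') + 1 - z) (by push_cast; linarith),
      fct_eq_facZ (x := a - b + f + g - y) (n := α₂ + D - y) (by push_cast; linarith),
      fct_eq_facZ (x := a + b + f + g + 1 - y) (n := α₁ + α₂ + α₃ + D + 1 - y)
        (by push_cast; linarith),
      fct_eq_facZ (x := 2 * g - y) (n := D + ε - y) (by push_cast; linarith),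
      fct_eq_facZ (x := f + g - e - y) (n := D - y) (by push_cast; linarith),
      fct_eq_facZ (x := e + f + g + 1 - y) (n := D + α₂ + α₃ + 1 - y) (by push_cast; linarith),
      fct_eq_facZ (x := c - d + f - z + x) (n := m + i2 - (P - x : ℕ) - z)
        (by push_cast [cx]; linarith),
      fct_eq_facZ (x := a - d + f + g - k + x - y) (n := m + i - (P - x : ℕ) - y)
        (by push_cast [cx]; linarith),
      fct_eq_facZ (x := a + c + g + k + 1 - z - y) (n := m + m2 + (i + i') + 1 - z - y)
        (by push_cast; linarith)]
    simp only [rfacZ, div_eq_mul_inv, mul_inv, pow_add]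
    ring
  · intro z x y hz
    rw [fct_eq_facZ (x := a + c - h - z) (n := m - z) (by push_cast; linarith),
      facZ_of_neg (n := m - z) (by omega)]
    simp
  · intro z x y hx
    rw [fct_eq_facZ (x := c + d - f - x) (n := P - x) (by push_cast; linarith),
      facZ_of_neg (n := P - x) (by omega)]
    simp
  · intro z x y hy
    rw [fct_eq_facZ (x := f + g - e - y) (n := D - y) (by push_cast; linarith),
      facZ_of_neg (n := D - y) (by omega)]
    simp

lemma Nsq_eq {x y z : ℚ} {p q r : ℕ} (hp : x + y - z = p) (hq : x - y + z = q)
    (hr : -x + y + z = r) :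
    Nsq x y z = facZ p * facZ q * facZ (p + q + r + 1) * rfacZ r := by
  rw [Nsq, fct_eq_facZ (x := x + y - z) (n := p) (by push_cast; linarith),
    fct_eq_facZ (x := x - y + z) (n := q) (by push_cast; linarith),
    fct_eq_facZ (x := x + y + z + 1) (n := p + q + r + 1) (by push_cast; linarith),
    fct_eq_facZ (x := y + z - x) (n := r) (by push_cast; linarith), div_eq_mul_inv, rfacZ]

/-- Equality of the Ališauskas–Jucys triple-sum formula for the SU(2) 9j
coefficient `{a b e; c d f; h k g}` and the new triple-sum formula obtained from
expansion (trsc) of the paper. -/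
theorem nineJ_tripleSum_A_eq_C (a b c d e f g h k : ℚ)
    (ha : IsNNHalfInt a) (hb : IsNNHalfInt b) (hc : IsNNHalfInt c)
    (hd : IsNNHalfInt d) (he : IsNNHalfInt e) (hf : IsNNHalfInt f)
    (hg : IsNNHalfInt g) (hh : IsNNHalfInt h) (hk : IsNNHalfInt k)
    (t1 : Triad a b e) (t2 : Triad c d f) (t3 : Triad h k g)
    (t4 : Triad a c h) (t5 : Triad b d k) (t6 : Triad e f g) :
    neg1pw (c + h - a) * Nsq a b e * sumSA a b c d e f g h k =
      neg1pw (c - d + f) * Nsq a c h * sumSC a b c d e f g h k := by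
  obtain ⟨⟨α₁, hα₁⟩, ⟨α₂, hα₂⟩, ⟨α₃, hα₃⟩⟩ := t1
  obtain ⟨⟨P, hP⟩, ⟨Q, hQ⟩, -⟩ := t2
  obtain ⟨⟨i', hi'⟩, ⟨i, hi⟩, ⟨m2, hm2⟩⟩ := t3
  obtain ⟨⟨m, hm⟩, ⟨i2', hi2'⟩, ⟨i2, hi2⟩⟩ := t4
  obtain ⟨-, -, ⟨r, hr⟩⟩ := t5
  obtain ⟨-, ⟨ε, hε⟩, ⟨D, hD⟩⟩ := t6
  rw [sumSA_eq hm hi2 hi' hi hm2 hα₁ hα₂ hα₃ hε hD hP,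
    sumSC_eq hm hi2 hi' hi hm2 hα₁ hα₂ hα₃ hε hD hP, Nsq_eq hα₁ hα₂ hα₃, Nsq_eq hm hi2' hi2,
    neg1pw_natCast (n := i2) (by linarith), neg1pw_natCast hQ, Finset.mul_sum, Finset.mul_sum]
  refine Finset.sum_congr rfl fun x hx => ?_
  have hx : x < P + 1 := by simpa using hx
  rcases lt_or_ge r x with hrx | hrx
  · rw [middleWeight, fct_eq_facZ (x := d - b + k - x) (n := r - x) (by push_cast; linarith),
      facZ_of_neg (n := r - x) (by omega)]
    simp
  obtain ⟨l, rfl⟩ := Nat.exists_eq_add_of_le (Nat.lt_succ_iff.mp hx)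
  rw [show x + l - x = l by omega]
  have hH : i + i' = i2 + i2' := by
    have : (i : ℚ) + i' = i2 + i2' := by linarith
    exact_mod_cast this
  have ha' : α₁ + α₂ = m + i2' := by
    have : (α₁ : ℚ) + α₂ = m + i2' := by linarith
    exact_mod_cast this
  have hg' : D + ε = m2 + i := by
    have : (D : ℚ) + ε = m2 + i := by linarith
    exact_mod_cast this
  have hl : α₁ + i2 ≤ i' + D + l := by
    have h1 : (x : ℚ) ≤ r := by exact_mod_cast hrx
    have h2 : (α₁ : ℚ) + i2 ≤ i' + D + l := by
      push_cast at hP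
      linarith
    exact_mod_cast h2
  have hs : Q + (x + l) = m + i2 := by
    have : (Q : ℚ) + (x + l) = m + i2 := by
      push_cast at hP
      linarith
    exact_mod_cast this
  have key := double_sum_eq m m2 i i' i2 i2' α₁ α₂ α₃ D ε l hH ha' hg' hl
  have hsign : (-1 : ℚ) ^ i2 * (-1) ^ x * (-1) ^ (m + l) = (-1) ^ Q := by
    rw [← pow_add, ← pow_add, show i2 + x + (m + l) = Q + 2 * (x + l) by omega, pow_add, pow_mul]
    simp
  have hN : ((m : ℤ) + i2' + i2 + 1) = m + i2 + i2' + 1 := by ring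
  rw [hN, ← hsign]
  linear_combination (-1) ^ i2 * (-1) ^ x * middleWeight b c d f k x * key
end
end
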